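/- arXiv:1408.1866 — 3 statements merged into one kernel-verified Lean document; each statement's English description precedes it below -/
import Mathlib

section
/- Let (X, d, μ) be a metric median algebra and M ⊆ N finite subalgebras of (X, μ). Let 𝒲(M⊂N) be the set of walls {h, hᶜ} of N for which h ∩ M and hᶜ ∩ M are both nonempty. Then for every {h,hᶜ} ∈ 𝒲(M⊂N), the pair {h ∩ M, hᶜ ∩ M} is a wall of M, giving a map ι^𝒲 : 𝒲(M⊂N) → 𝒲(M), and for every wall W of M one has λ_max^M(W) ≤ Σ_{V ∈ (ι^𝒲)⁻¹(W)} λ_max^N(V). -/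
/-- The axioms of a median algebra for a ternary operation. -/
def IsMedianFn {X : Type*} (μ : X → X → X → X) : Prop :=
  (∀ x y z, μ x y z = μ x z y) ∧ (∀ x y z, μ x y z = μ y z x) ∧
    (∀ x y, μ x x y = x) ∧
    ∀ x y z u v, μ (μ x y z) u v = μ x (μ y u v) (μ z u v)

/-- A subset closed under the median operation. -/
def IsSubalgebra {X : Type*} (μ : X → X → X → X) (M : Set X) : Prop :=
  ∀ a ∈ M, ∀ b ∈ M, ∀ c ∈ M, μ a b c ∈ M

/-- `h` is convex in the subalgebra `M`: it contains `I(a,b) ∩ M` for all `a, b ∈ h`. -/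
def ConvexIn {X : Type*} (μ : X → X → X → X) (M h : Set X) : Prop :=
  ∀ a ∈ h, ∀ b ∈ h, ∀ z ∈ M, μ a b z = z → z ∈ h

/-- A halfspace of the subalgebra `M`: one side of a wall of `M`, i.e. a nonempty convex
subset of `M` with nonempty convex complement `M \ h`.  Walls of `M` correspond to
(unordered) pairs `{h, M \ h}` of complementary halfspaces. -/
def IsHalfspaceIn {X : Type*} (μ : X → X → X → X) (M h : Set X) : Prop :=
  h ⊆ M ∧ h.Nonempty ∧ (M \ h).Nonempty ∧ ConvexIn μ M h ∧ ConvexIn μ M (M \ h)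

/-- `a` and `b` are adjacent (form an edge) in `M` if exactly one wall of `M` separates
them; separating walls are represented by the halfspace containing `a` and not `b`. -/
def AdjacentIn {X : Type*} (μ : X → X → X → X) (M : Set X) (a b : X) : Prop :=
  a ∈ M ∧ b ∈ M ∧ ∃! h : Set X, IsHalfspaceIn μ M h ∧ a ∈ h ∧ b ∉ h

/-- `λ_max^M(W)` for the wall `W = {h, M \ h}`: the maximal length `d(a,b)` of an edge
`{a,b}` of `M` crossing the wall. -/
noncomputable def lamMax {X : Type*} [MetricSpace X] (μ : X → X → X → X) (M h : Set X) : ℝ :=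
  sSup {r : ℝ | ∃ a b, AdjacentIn μ M a b ∧ a ∈ h ∧ b ∈ M \ h ∧ r = dist a b}

/-- `d_μ^M(x,y) = Σ_{W ∈ 𝒲^M(x|y)} λ_max^M(W)` if `x, y ∈ M` and `0` otherwise; the walls
separating `x` from `y` are represented by their halfspaces containing `x` and not `y`. -/
noncomputable def dmuM {X : Type*} [MetricSpace X] (μ : X → X → X → X) (M : Set X)
    (x y : X) : ℝ :=
  ∑ᶠ h ∈ {h : Set X | IsHalfspaceIn μ M h ∧ x ∈ h ∧ y ∈ M \ h}, lamMax μ M h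

section Separation

variable {X : Type*} {μ : X → X → X → X} {N : Set X}

namespace IsMedianFn

theorem median_absorb (hmed : IsMedianFn μ) (a b x : X) : μ a x (μ a b x) = μ a b x := by
  obtain ⟨h1, h2, h3, h4⟩ := hmed
  calc μ a x (μ a b x) = μ (μ b a x) a x := by grind
    _ = μ b (μ a a x) (μ x a x) := h4 ..
    _ = μ a b x := by grind

theorem interval_trans (hmed : IsMedianFn μ) {a b c z : X} (hc : μ a b c = c)
    (hz : μ a c z = z) : μ a b z = z := by
  obtain ⟨h1, h2, h3, h4⟩ := hmed
  calc μ a b z = μ b (μ a a z) (μ c a z) := by grind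
    _ = μ (μ b a c) a z := (h4 ..).symm
    _ = z := by grind

end IsMedianFn

theorem IsHalfspaceIn.median_mem {h : Set X} (hmed : IsMedianFn μ) (hN : IsSubalgebra μ N)
    (hh : IsHalfspaceIn μ N h) {a b x : X} (ha : a ∈ h) (hb : b ∈ N) (hx : x ∈ h) :
    μ a b x ∈ h :=
  hh.2.2.2.1 a ha x hx _ (hN a (hh.1 ha) b hb x (hh.1 hx)) (hmed.median_absorb a b x)

theorem IsHalfspaceIn.compl {h : Set X} (hh : IsHalfspaceIn μ N h) :
    IsHalfspaceIn μ N (N \ h) := by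
  obtain ⟨h1, h2, h3, h4, h5⟩ := hh
  refine ⟨Set.sdiff_subset, h3, ?_, h5, ?_⟩ <;> rwa [Set.sdiff_sdiff_cancel_left h1]

/-- A pair of points with no further point in the interval between them is separated by
the fibre of the gate projection onto that interval. -/
theorem isHalfspaceIn_fibre (hmed : IsMedianFn μ) (hN : IsSubalgebra μ N) {a b : X}
    (ha : a ∈ N) (hb : b ∈ N) (hab : a ≠ b)
    (hgap : ∀ c ∈ N, μ a b c = c → c = a ∨ c = b) :
    IsHalfspaceIn μ N {x ∈ N | μ a b x = a} := by
  have habs := hmed.median_absorb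
  obtain ⟨h1, h2, h3, h4⟩ := hmed
  have hval : ∀ x ∈ N, μ a b x = a ∨ μ a b x = b := fun x hx =>
    hgap _ (hN a ha b hb x hx) (by grind)
  have hproj : ∀ x y z, μ x y z = z → μ a b z = μ x (μ a b y) (μ a b z) := by
    intro x y z hz
    have := h4 x y z a b
    grind
  have hdiff : N \ {x ∈ N | μ a b x = a} = {x ∈ N | μ a b x = b} := by
    ext x
    have := hval x
    grind
  refine ⟨Set.sep_subset _ _, ⟨a, ha, by grind⟩, hdiff ▸ ⟨b, hb, by grind⟩, ?_, hdiff ▸ ?_⟩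
  · rintro x ⟨hx, hxa⟩ y ⟨hy, hya⟩ z hz hxyz
    refine ⟨hz, (hval z hz).resolve_right fun hzb => hab ?_⟩
    have := hproj x y z hxyz
    grind
  · rintro x ⟨hx, hxb⟩ y ⟨hy, hyb⟩ z hz hxyz
    refine ⟨hz, (hval z hz).resolve_left fun hza => hab ?_⟩
    have := hproj x y z hxyz
    grind

/-- Distinct points of a finite subalgebra are separated by a wall. -/
theorem exists_isHalfspaceIn_separating (hmed : IsMedianFn μ) (hN : IsSubalgebra μ N)
    (hfin : N.Finite) {a b : X} (ha : a ∈ N) (hb : b ∈ N) (hab : a ≠ b) :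
    ∃ h, IsHalfspaceIn μ N h ∧ a ∈ h ∧ b ∉ h := by
  induction hn : {z ∈ N | μ a b z = z}.ncard using Nat.strong_induction_on generalizing b with
  | _ n ih =>
  subst hn
  by_cases hgap : ∀ c ∈ N, μ a b c = c → c = a ∨ c = b
  · refine ⟨_, isHalfspaceIn_fibre hmed hN ha hb hab hgap, ⟨ha, ?_⟩, fun hbb => hab ?_⟩
    · obtain ⟨h1, h2, h3, h4⟩ := hmed
      grind
    · obtain ⟨h1, h2, h3, h4⟩ := hmed
      have := hbb.2
      grind
  · push Not at hgap
    obtain ⟨c, hc, habc, hca, hcb⟩ := hgap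
    have hlt : {z ∈ N | μ a c z = z}.ncard < {z ∈ N | μ a b z = z}.ncard := by
      refine Set.ncard_lt_ncard ⟨fun z hz => ⟨hz.1, hmed.interval_trans habc hz.2⟩, ?_⟩
        (hfin.subset (Set.sep_subset _ _))
      intro hsub
      obtain ⟨h1, h2, h3, h4⟩ := hmed
      have : μ a c b = b := (hsub ⟨hb, by grind⟩).2
      grind
    obtain ⟨h, hh, hah, hch⟩ := ih _ hlt hc hca.symm rfl
    exact ⟨h, hh, hah, fun hbh => hch (hh.2.2.2.1 a hah b hbh c hc habc)⟩

/-- Two walls separating `a` from `b` are distinguished by a point of the interval. -/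
theorem exists_between_of_halfspaces_ne (hmed : IsMedianFn μ) (hN : IsSubalgebra μ N)
    {a b : X} {h h' : Set X} (hh : IsHalfspaceIn μ N h) (hh' : IsHalfspaceIn μ N h')
    (ha : a ∈ h) (hb : b ∈ N \ h) (ha' : a ∈ h') (hb' : b ∈ N \ h') (hne : h ≠ h') :
    ∃ c ∈ N, μ a b c = c ∧ c ≠ a ∧ c ≠ b := by
  wlog hsub : ¬ h ⊆ h' generalizing h h'
  · exact this hh' hh ha' hb' ha hb hne.symm
      fun hsub' => hne ((not_not.mp hsub).antisymm hsub')
  obtain ⟨x, hx, hx'⟩ := Set.not_subset.mp hsub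
  have haN := hh.1 ha
  have hxN := hh.1 hx
  have hc : μ a b x ∈ h := hh.median_mem hmed hN ha hb.1 hx
  have hc' : μ b a x ∈ N \ h' := hh'.compl.median_mem hmed hN hb' haN ⟨hxN, hx'⟩
  have habs := hmed.median_absorb a x b
  obtain ⟨h1, h2, h3, h4⟩ := hmed
  have hswap : μ b a x = μ a b x := by grind
  rw [hswap] at hc'
  refine ⟨μ a b x, hc'.1, by grind, ?_, ?_⟩
  · intro heq
    rw [heq] at hc'
    exact hc'.2 ha'
  · intro heq
    rw [heq] at hc
    exact hb.2 hc

/-- A wall of `N` both of whose sides meet `M` induces a wall of `M`. -/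
theorem IsHalfspaceIn.inter {M h : Set X} (hMN : M ⊆ N) (hh : IsHalfspaceIn μ N h)
    (hne : (h ∩ M).Nonempty) (hne' : ((N \ h) ∩ M).Nonempty) :
    IsHalfspaceIn μ M (h ∩ M) := by
  obtain ⟨-, -, -, hconv, hconv'⟩ := hh
  obtain ⟨y, hy, hyM⟩ := hne'
  refine ⟨Set.inter_subset_right, hne, ⟨y, hyM, fun hyh => hy.2 hyh.1⟩, ?_, ?_⟩
  · intro a ha b hb z hz habz
    exact ⟨hconv a ha.1 b hb.1 z (hMN hz) habz, hz⟩
  · intro a ha b hb z hz habz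
    exact ⟨hz, fun hzh => (hconv' a ⟨hMN ha.1, fun h => ha.2 ⟨h, ha.1⟩⟩ b
      ⟨hMN hb.1, fun h => hb.2 ⟨h, hb.1⟩⟩ z (hMN hz) habz).2 hzh.1⟩

theorem finite_setOf_isHalfspaceIn (hfin : N.Finite) : {h | IsHalfspaceIn μ N h}.Finite :=
  hfin.finite_subsets.subset fun _ hh => hh.1

theorem separating_eq_union {a b c : X} (haN : a ∈ N) (hb : b ∈ N) (hc : c ∈ N) (habc : μ a b c = c) :
    {h | IsHalfspaceIn μ N h ∧ a ∈ h ∧ b ∉ h} =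
      {h | IsHalfspaceIn μ N h ∧ a ∈ h ∧ c ∉ h} ∪
        {h | IsHalfspaceIn μ N h ∧ c ∈ h ∧ b ∉ h} := by
  ext h
  constructor
  · rintro ⟨hh, ha, hbh⟩
    by_cases hch : c ∈ h
    · exact Or.inr ⟨hh, hch, hbh⟩
    · exact Or.inl ⟨hh, ha, hch⟩
  · rintro (⟨hh, ha, hch⟩ | ⟨hh, hch, hbh⟩)
    · exact ⟨hh, ha, fun hbh => hch (hh.2.2.2.1 a ha b hbh c hc habc)⟩
    · refine ⟨hh, ?_, hbh⟩
      by_contra ha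
      exact (hh.2.2.2.2 a ⟨haN, ha⟩ b ⟨hb, hbh⟩ c hc habc).2 hch

end Separation

section Metric

variable {X : Type*} [MetricSpace X] {μ : X → X → X → X} {N : Set X}

theorem lamMax_nonneg (h : Set X) : 0 ≤ lamMax μ N h := by
  refine Real.sSup_nonneg ?_
  rintro r ⟨a, b, -, -, -, rfl⟩
  exact dist_nonneg

theorem dist_le_lamMax (hfin : N.Finite) {h : Set X} {a b : X} (hadj : AdjacentIn μ N a b)
    (ha : a ∈ h) (hb : b ∉ h) : dist a b ≤ lamMax μ N h := by
  refine le_csSup ?_ ⟨a, b, hadj, ha, ⟨hadj.2.1, hb⟩, rfl⟩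
  refine (((hfin.prod hfin).image fun p : X × X => dist p.1 p.2).subset ?_).bddAbove
  rintro r ⟨x, y, hxy, -, -, rfl⟩
  exact ⟨(x, y), ⟨hxy.1, hxy.2.1⟩, rfl⟩

/-- The distance between two points of a finite subalgebra is at most the total `lamMax` of
the walls separating them. -/
theorem dist_le_finsum_lamMax (hmed : IsMedianFn μ) (hN : IsSubalgebra μ N) (hfin : N.Finite)
    {a b : X} (ha : a ∈ N) (hb : b ∈ N) :
    dist a b ≤ ∑ᶠ h ∈ {h | IsHalfspaceIn μ N h ∧ a ∈ h ∧ b ∉ h}, lamMax μ N h := by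
  have hfinS : ∀ x y, {h | IsHalfspaceIn μ N h ∧ x ∈ h ∧ y ∉ h}.Finite := fun x y =>
    (finite_setOf_isHalfspaceIn hfin).subset fun _ hh => hh.1
  induction hn : {h | IsHalfspaceIn μ N h ∧ a ∈ h ∧ b ∉ h}.ncard
    using Nat.strong_induction_on generalizing a b with
  | _ n ih =>
  subst hn
  rcases eq_or_ne a b with rfl | hab
  · simp
  obtain ⟨h, hh, hah, hbh⟩ := exists_isHalfspaceIn_separating hmed hN hfin ha hb hab
  by_cases huniq : ∀ h', IsHalfspaceIn μ N h' ∧ a ∈ h' ∧ b ∉ h' → h' = h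
  · have hS : {h | IsHalfspaceIn μ N h ∧ a ∈ h ∧ b ∉ h} = {h} :=
      Set.eq_singleton_iff_unique_mem.mpr ⟨⟨hh, hah, hbh⟩, huniq⟩
    rw [hS, finsum_mem_singleton]
    exact dist_le_lamMax hfin ⟨ha, hb, h, ⟨hh, hah, hbh⟩, huniq⟩ hah hbh
  push Not at huniq
  obtain ⟨h', ⟨hh', hah', hbh'⟩, hne⟩ := huniq
  obtain ⟨c, hc, habc, hca, hcb⟩ :=
    exists_between_of_halfspaces_ne hmed hN hh' hh hah' ⟨hb, hbh'⟩ hah ⟨hb, hbh⟩ hne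
  have hunion := separating_eq_union ha hb hc habc
  have hdisj : Disjoint {h | IsHalfspaceIn μ N h ∧ a ∈ h ∧ c ∉ h}
      {h | IsHalfspaceIn μ N h ∧ c ∈ h ∧ b ∉ h} :=
    Set.disjoint_left.mpr fun _ h1 h2 => h1.2.2 h2.2.1
  have hcard := Set.ncard_union_eq hdisj (hfinS a c) (hfinS c b)
  have hpos₁ := (Set.ncard_pos (hfinS a c)).mpr
    (exists_isHalfspaceIn_separating hmed hN hfin ha hc hca.symm)
  have hpos₂ := (Set.ncard_pos (hfinS c b)).mpr
    (exists_isHalfspaceIn_separating hmed hN hfin hc hb hcb)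
  rw [← hunion] at hcard
  rw [hunion, finsum_mem_union hdisj (hfinS a c) (hfinS c b)]
  exact (dist_triangle a c b).trans
    (add_le_add (ih _ (by omega) ha hc rfl) (ih _ (by omega) hc hb rfl))

end Metric

/-- For finite subalgebras `M ⊆ N` of a metric median algebra `(X, d, μ)`:
every wall of `N` both of whose sides meet `M` induces a wall of `M` (this is the map
`ι^𝒲 : 𝒲(M ⊂ N) → 𝒲(M)`, in halfspace form `h ↦ h ∩ M`), and for every wall `W` of `M`,
`λ_max^M(W) ≤ Σ_{V ∈ (ι^𝒲)⁻¹(W)} λ_max^N(V)`, the sum being over the walls of `N`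
inducing `W` (represented by their halfspaces `h` with `h ∩ M = h₀`). -/
theorem stmt_4 {X : Type*} [MetricSpace X] (μ : X → X → X → X)
    (hmed : IsMedianFn μ)
    (hcont : Continuous fun p : X × X × X => μ p.1 p.2.1 p.2.2)
    (M N : Set X) (hMfin : M.Finite) (hNfin : N.Finite)
    (hMsub : IsSubalgebra μ M) (hNsub : IsSubalgebra μ N) (hMN : M ⊆ N) :
    (∀ h : Set X, IsHalfspaceIn μ N h → (h ∩ M).Nonempty → ((N \ h) ∩ M).Nonempty →
        IsHalfspaceIn μ M (h ∩ M)) ∧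
      ∀ h₀ : Set X, IsHalfspaceIn μ M h₀ →
        lamMax μ M h₀ ≤ ∑ᶠ h ∈ {h : Set X | IsHalfspaceIn μ N h ∧ h ∩ M = h₀}, lamMax μ N h := by
  refine ⟨fun h hh hne hne' => hh.inter hMN hne hne', fun h₀ hh₀ => ?_⟩
  refine Real.sSup_le ?_ (finsum_nonneg fun h => finsum_nonneg fun _ => lamMax_nonneg h)
  rintro r ⟨a, b, ⟨haM, hbM, huniq⟩, ha, hb, rfl⟩
  have hS : {h : Set X | IsHalfspaceIn μ N h ∧ h ∩ M = h₀} =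
      {h | IsHalfspaceIn μ N h ∧ a ∈ h ∧ b ∉ h} := by
    ext h
    constructor
    · rintro ⟨hh, rfl⟩
      exact ⟨hh, ha.1, fun hbh => hb.2 ⟨hbh, hbM⟩⟩
    · rintro ⟨hh, hah, hbh⟩
      exact ⟨hh, huniq.unique ⟨hh.inter hMN ⟨a, hah, haM⟩ ⟨b, ⟨hMN hbM, hbh⟩, hbM⟩,
        ⟨hah, haM⟩, fun hbh' => hbh hbh'.1⟩ ⟨hh₀, ha, hb.2⟩⟩
  rw [hS]
  exact dist_le_finsum_lamMax hmed hNsub hNfin (hMN haM) (hMN hbM)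
end

section
/- For all n ∈ ℕ, k > 0 and l ≥ 1 there exists L ≥ 0 such that the following holds: if (X, d, μ) is a metric median algebra of rank at most n satisfying (i) d(μ(a,b,c), μ(a,b,c̃)) ≤ k·d(c, c̃) for all a,b,c,c̃ ∈ X, and (ii) for all x,y ∈ X there is an l-Lipschitz map c : [0, d(x,y)] → X with c(0) = x and c(d(x,y)) = y, then (X,d,μ) is uniformly rectifiable with constant L, i.e. d_μ(x,y) ≤ L·d(x,y) for all x,y ∈ X. -/
universe u

/-- The coordinatewise majority (median) operation on the `m`-cube `{0,1}^m`. -/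
def cubeMedian (m : ℕ) (x y z : Fin m → Bool) : Fin m → Bool :=
  fun i => (x i && y i) || (y i && z i) || (z i && x i)

/-- A median algebra has rank at most `n` if it contains no `(n+1)`-cube, i.e. no
subalgebra isomorphic (via an injective median homomorphism) to the `(n+1)`-cube with
its coordinatewise majority operation. -/
def RankLE {X : Type*} (μ : X → X → X → X) (n : ℕ) : Prop :=
  ¬∃ f : (Fin (n + 1) → Bool) → X, Function.Injective f ∧
      ∀ x y z, f (cubeMedian (n + 1) x y z) = μ (f x) (f y) (f z)

/-- A finite set of grid cells without two cells in strictly decreasing position has small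
total weight, where the weight of a cell depends only on its column. -/
lemma sum_le_of_no_descent (N T : ℕ) (w : ℕ → ℝ) (ε : ℝ) (hε0 : 0 ≤ ε) (hw : ∀ t, 0 ≤ w t)
    (hε : ∀ t < T, w t ≤ ε) (B : Finset (ℕ × ℕ))
    (hB : B ⊆ Finset.range N ×ˢ Finset.range T)
    (hanti : ∀ a ∈ B, ∀ b ∈ B, ¬ (a.1 < b.1 ∧ b.2 < a.2)) :
    ∑ a ∈ B, w a.2 ≤ N * ε + 2 * ∑ t ∈ Finset.range T, w t := by
  classical
  have mem : ∀ a ∈ B, a.1 < N ∧ a.2 < T := fun a ha => by simpa using hB ha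
  have column : ∀ C ⊆ B, Set.InjOn Prod.snd (C : Set (ℕ × ℕ)) →
      ∑ a ∈ C, w a.2 ≤ ∑ t ∈ Finset.range T, w t := by
    intro C hC hinj
    rw [← Finset.sum_image (f := w) hinj]
    refine Finset.sum_le_sum_of_subset_of_nonneg ?_ fun t _ _ => hw t
    intro t ht
    obtain ⟨a, ha, rfl⟩ := Finset.mem_image.1 ht
    exact Finset.mem_range.2 (mem a (hC ha)).2
  let U := B.filter fun a => ∃ t, (a.1, t) ∈ B ∧ a.2 < t
  let D := B.filter fun a => ∃ t, (a.1, t) ∈ B ∧ t < a.2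
  let S := B \ (U ∪ D)
  have hU : ∑ a ∈ U, w a.2 ≤ ∑ t ∈ Finset.range T, w t := by
    refine column U (Finset.filter_subset _ _) ?_
    rintro ⟨i, t⟩ ha ⟨j, t'⟩ hb (rfl : t = t')
    simp only [U, Finset.coe_filter, Set.mem_ofPred_eq] at ha hb
    obtain ⟨ha, s, hs, hts⟩ := ha
    obtain ⟨hb, s', hs', hts'⟩ := hb
    have h1 := hanti _ hs _ hb
    have h2 := hanti _ hs' _ ha
    simp only [Prod.mk.injEq, and_true] at *
    omega
  have hD : ∑ a ∈ D, w a.2 ≤ ∑ t ∈ Finset.range T, w t := by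
    refine column D (Finset.filter_subset _ _) ?_
    rintro ⟨i, t⟩ ha ⟨j, t'⟩ hb (rfl : t = t')
    simp only [D, Finset.coe_filter, Set.mem_ofPred_eq] at ha hb
    obtain ⟨ha, s, hs, hts⟩ := ha
    obtain ⟨hb, s', hs', hts'⟩ := hb
    have h1 := hanti _ ha _ hs'
    have h2 := hanti _ hb _ hs
    simp only [Prod.mk.injEq, and_true] at *
    omega
  have hS : ∑ a ∈ S, w a.2 ≤ N * ε := by
    have hSB : S ⊆ B := Finset.sdiff_subset
    have hinj : Set.InjOn Prod.fst (S : Set (ℕ × ℕ)) := by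
      rintro ⟨i, t⟩ ha ⟨j, t'⟩ hb (rfl : i = j)
      have hb' := hSB hb
      simp only [S, U, D, Finset.coe_sdiff, Set.mem_sdiff, Finset.mem_coe, Finset.mem_union,
        Finset.mem_filter, not_or, not_and, not_exists, not_lt] at ha
      have h1 := ha.2.1 ha.1 t' hb'
      have h2 := ha.2.2 ha.1 t' hb'
      simp only [Prod.mk.injEq, true_and]
      omega
    have hcard : (S.card : ℝ) ≤ N := by
      have : S.card ≤ (Finset.range N).card :=
        Finset.card_le_card_of_injOn Prod.fst
          (fun a ha => Finset.mem_coe.2 (Finset.mem_range.2 (mem a (hSB ha)).1)) hinj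
      exact_mod_cast this.trans_eq (Finset.card_range N)
    calc ∑ a ∈ S, w a.2 ≤ ∑ a ∈ S, ε := Finset.sum_le_sum fun b hb => hε _ (mem b (hSB hb)).2
        _ = S.card * ε := by simp
        _ ≤ N * ε := by gcongr
  have hsub : B ⊆ S ∪ (U ∪ D) := by
    intro a ha
    by_cases h : a ∈ U ∪ D
    · exact Finset.mem_union_right _ h
    · exact Finset.mem_union_left _ (Finset.mem_sdiff.2 ⟨ha, h⟩)
  have hun : ∀ C C' : Finset (ℕ × ℕ), ∑ a ∈ C ∪ C', w a.2 ≤ ∑ a ∈ C, w a.2 + ∑ a ∈ C', w a.2 := by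
    intro C C'
    rw [← Finset.sum_union_inter]
    exact le_add_of_nonneg_right (Finset.sum_nonneg fun a _ => hw _)
  have h1 := Finset.sum_le_sum_of_subset_of_nonneg hsub fun a _ _ => hw a.2
  have h2 := hun S (U ∪ D)
  have h3 := hun U D
  linarith

/-- A finite set of grid cells without strictly decreasing sequences of length `n + 1` has small
total weight, where the weight of a cell depends only on its column. -/
lemma sum_le_of_no_descending_list (N T : ℕ) (w : ℕ → ℝ) (ε : ℝ) (hε0 : 0 ≤ ε)
    (hw : ∀ t, 0 ≤ w t) (hε : ∀ t < T, w t ≤ ε) (n : ℕ) (A : Finset (ℕ × ℕ))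
    (hA : A ⊆ Finset.range N ×ˢ Finset.range T)
    (hlist : ∀ s : List (ℕ × ℕ), s.Pairwise (fun a b => a.1 < b.1 ∧ b.2 < a.2) →
      (∀ a ∈ s, a ∈ A) → s.length ≠ n + 1) :
    ∑ a ∈ A, w a.2 ≤ n * (N * ε + 2 * ∑ t ∈ Finset.range T, w t) := by
  classical
  induction n generalizing A with
  | zero =>
    have : A = ∅ := by
      refine Finset.eq_empty_of_forall_notMem fun a ha => ?_
      exact hlist [a] (List.pairwise_singleton _ _) (by simpa using ha) rfl
    simp [this]
  | succ n ih =>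
    let A' := A.filter fun b => ∃ a ∈ A, a.1 < b.1 ∧ b.2 < a.2
    have hA' : A' ⊆ A := Finset.filter_subset _ _
    have h1 := ih A' (hA'.trans hA) (by
      rintro s hs hsA hlen
      match s, hs, hsA, hlen with
      | b :: s, hs, hsA, hlen =>
        obtain ⟨a, ha, hab⟩ := (Finset.mem_filter.1 (hsA b List.mem_cons_self)).2
        refine hlist (a :: b :: s) (List.pairwise_cons.2 ⟨fun c hc => ?_, hs⟩) ?_ (by simpa using hlen)
        · rcases List.mem_cons.1 hc with rfl | hc
          · exact hab
          · have := (List.pairwise_cons.1 hs).1 c hc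
            omega
        · intro c hc
          rcases List.mem_cons.1 hc with rfl | hc
          · exact ha
          · exact hA' (hsA c hc))
    have h2 := sum_le_of_no_descent N T w ε hε0 hw hε (A \ A') (Finset.sdiff_subset.trans hA) (by
      intro a ha b hb hab
      have ha := (Finset.mem_sdiff.1 ha).1
      have hb := Finset.mem_sdiff.1 hb
      exact hb.2 (Finset.mem_filter.2 ⟨hb.1, a, ha, hab⟩))
    rw [← Finset.sum_sdiff hA']
    push_cast
    linarith

/-- Elements of a distributive lattice that are independent modulo the `r j` span a cube. -/
lemma exists_cube {α : Type*} [DistribLattice α] [OrderBot α] {m : ℕ} (g r : Fin m → α)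
    (hgr : ∀ j, ¬ g j ≤ r j) (hne : ∀ i j, i ≠ j → g i ≤ r j) :
    ∃ f : (Fin m → Bool) → α, Function.Injective f ∧
      (∀ x y, f (x ⊓ y) = f x ⊓ f y) ∧ ∀ x y, f (x ⊔ y) = f x ⊔ f y := by
  let v := Finset.univ.sup fun j => g j ⊓ r j
  let A : (Fin m → Bool) → α := fun x => Finset.univ.sup fun j => if x j then g j else ⊥
  have hmem : ∀ x j, x j = true → g j ≤ A x := fun x j h => by
    have := Finset.le_sup (f := fun j => if x j then g j else ⊥) (Finset.mem_univ j)
    simpa [h] using this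
  have hA : ∀ x c, (∀ j, x j = true → g j ≤ c) → A x ≤ c := fun x c h => by
    refine Finset.sup_le fun j _ => ?_
    split_ifs with hj
    · exact h j hj
    · exact bot_le
  have hv : ∀ j, v ≤ r j := fun j => Finset.sup_le fun i _ => by
    by_cases h : i = j
    · exact h ▸ inf_le_right
    · exact inf_le_left.trans (hne i j h)
  have hle : ∀ x y, v ⊔ A x ≤ v ⊔ A y → ∀ j, x j = true → y j = true := by
    intro x y h j hj
    by_contra hy
    refine hgr j ((hmem x j hj).trans ((le_sup_right.trans h).trans (sup_le (hv j) ?_)))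
    refine hA _ _ fun i hi => hne i j ?_
    rintro rfl
    exact hy hi
  refine ⟨fun x => v ⊔ A x, ?_, ?_, ?_⟩
  · intro x y h
    funext j
    exact Bool.eq_iff_iff.2 ⟨hle x y (le_of_eq h) j, hle y x (ge_of_eq h) j⟩
  · intro x y
    apply le_antisymm
    · refine le_inf (sup_le_sup_left (hA _ _ fun j hj => hmem x j ?_) _)
        (sup_le_sup_left (hA _ _ fun j hj => hmem y j ?_) _) <;>
      simp at hj <;> simp [hj]
    · rw [← sup_inf_left]
      refine sup_le le_sup_left ?_
      simp only [A]
      rw [Finset.sup_inf_sup]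
      refine Finset.sup_le fun p _ => ?_
      split_ifs with h1 h2
      · by_cases h : p.1 = p.2
        · exact inf_le_left.trans ((hmem (x ⊓ y) p.1 (by
            rw [← h] at h2; simp [h1, h2])).trans le_sup_right)
        · refine le_trans ?_ le_sup_left
          exact (inf_le_inf_left _ (hne _ _ (Ne.symm h))).trans
            (Finset.le_sup (f := fun j => g j ⊓ r j) (Finset.mem_univ p.1))
      all_goals simp
  · intro x y
    change v ⊔ A (x ⊔ y) = v ⊔ A x ⊔ (v ⊔ A y)
    rw [← sup_sup_distrib_left]
    congr 1
    apply le_antisymm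
    · refine hA _ _ fun j hj => ?_
      simp only [Pi.sup_apply, Bool.max_eq_or, Bool.or_eq_true] at hj
      exact hj.elim (fun h => (hmem x j h).trans le_sup_left)
        fun h => (hmem y j h).trans le_sup_right
    · refine sup_le (hA _ _ fun j hj => hmem _ j ?_) (hA _ _ fun j hj => hmem _ j ?_) <;>
      simp [hj]

/-- In a distributive lattice without `(n + 1)`-cubes, the length of a chain is controlled by
that of any other chain with the same end points whose steps are at most `ε`. -/
lemma sum_dist_chain_le {α : Type*} [DistribLattice α] [OrderBot α] [PseudoMetricSpace α]
    (n : ℕ) (k : ℝ) (hk : 0 ≤ k)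
    (hinf : ∀ a b c : α, dist (a ⊓ b) (a ⊓ c) ≤ k * dist b c)
    (hsup : ∀ a b c : α, dist (a ⊔ b) (a ⊔ c) ≤ k * dist b c)
    (hcube : ¬ ∃ f : (Fin (n + 1) → Bool) → α, Function.Injective f ∧
      (∀ x y, f (x ⊓ y) = f x ⊓ f y) ∧ ∀ x y, f (x ⊔ y) = f x ⊔ f y)
    (z q : ℕ → α) (hz : Monotone z) (hq : Monotone q) (N T : ℕ) (h0 : q 0 ≤ z 0)
    (hT : z N ≤ q T) (ε : ℝ) (hε0 : 0 ≤ ε) (hε : ∀ t < T, dist (q t) (q (t + 1)) ≤ ε) :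
    ∑ i ∈ Finset.range N, dist (z i) (z (i + 1)) ≤
      k * k * (n * (N * ε + 2 * (T * ε))) := by
  classical
  let A := (Finset.range N ×ˢ Finset.range T).filter
    fun a => ¬ z (a.1 + 1) ⊓ q (a.2 + 1) ≤ z a.1 ⊔ q a.2
  let w : ℕ → ℝ := fun t => dist (q t) (q (t + 1))
  have hcells : ∑ a ∈ A, w a.2 ≤ n * (N * ε + 2 * ∑ t ∈ Finset.range T, w t) := by
    refine sum_le_of_no_descending_list N T w ε hε0 (fun t => dist_nonneg) hε n A
      (Finset.filter_subset _ _) ?_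
    intro s hs hsA hlen
    rw [List.pairwise_iff_get] at hs
    let e : Fin (n + 1) → Fin s.length := Fin.cast hlen.symm
    have hlt : ∀ i j, i < j →
        (s.get (e i)).1 < (s.get (e j)).1 ∧ (s.get (e j)).2 < (s.get (e i)).2 :=
      fun i j hij => hs (e i) (e j) hij
    refine hcube (exists_cube (fun j => z ((s.get (e j)).1 + 1) ⊓ q ((s.get (e j)).2 + 1))
      (fun j => z (s.get (e j)).1 ⊔ q (s.get (e j)).2) (fun j => ?_) fun i j hij => ?_)
    · exact (Finset.mem_filter.1 (hsA _ (List.get_mem s (e j)))).2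
    · rcases lt_or_gt_of_ne hij with h | h
      · exact inf_le_left.trans ((hz (hlt i j h).1).trans le_sup_left)
      · exact inf_le_right.trans ((hq (hlt j i h).2).trans le_sup_right)
  have hstep : ∀ i < N, dist (z i) (z (i + 1)) ≤
      ∑ t ∈ Finset.range T, if (i, t) ∈ A then k * k * w t else 0 := by
    intro i hi
    let u : ℕ → α := fun t => z i ⊔ (z (i + 1) ⊓ q t)
    have hu0 : u 0 = z i :=
      sup_eq_left.2 (inf_le_right.trans (h0.trans (hz (Nat.zero_le i))))
    have huT : u T = z (i + 1) := by
      have h1 : z (i + 1) ≤ q T := (hz hi).trans hT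
      simp only [u]
      rw [inf_eq_left.2 h1, sup_eq_right.2 (hz (Nat.le_succ i))]
    rw [← hu0, ← huT]
    refine dist_le_range_sum_of_dist_le T fun {t} ht => ?_
    split_ifs with hA
    · rw [mul_assoc]
      exact (hsup _ _ _).trans (mul_le_mul_of_nonneg_left (hinf _ _ _) hk)
    · have hA : z (i + 1) ⊓ q (t + 1) ≤ z i ⊔ q t := by
        by_contra h
        exact hA (Finset.mem_filter.2 ⟨by simpa using ⟨hi, ht⟩, h⟩)
      have : u (t + 1) = u t := by
        apply le_antisymm
        · refine sup_le le_sup_left ?_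
          simp only [u]
          rw [sup_inf_left, sup_eq_right.2 (hz (Nat.le_succ i))]
          exact le_inf inf_le_left hA
        · exact sup_le_sup_left (inf_le_inf_left _ (hq (Nat.le_succ t))) _
      rw [this, dist_self]
  have hwsum : ∑ t ∈ Finset.range T, w t ≤ T * ε := by
    calc ∑ t ∈ Finset.range T, w t ≤ ∑ t ∈ Finset.range T, ε :=
          Finset.sum_le_sum fun t ht => hε t (Finset.mem_range.1 ht)
      _ = T * ε := by simp
  calc ∑ i ∈ Finset.range N, dist (z i) (z (i + 1))
      ≤ ∑ i ∈ Finset.range N, ∑ t ∈ Finset.range T, if (i, t) ∈ A then k * k * w t else 0 :=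
        Finset.sum_le_sum fun i hi => hstep i (Finset.mem_range.1 hi)
    _ = ∑ a ∈ A, k * k * w a.2 := by
        rw [← Finset.sum_product', ← Finset.sum_filter, Finset.filter_mem_eq_inter,
          Finset.inter_eq_right.2 (Finset.filter_subset _ _)]
    _ = k * k * ∑ a ∈ A, w a.2 := by rw [Finset.mul_sum]
    _ ≤ _ := by
        refine mul_le_mul_of_nonneg_left (hcells.trans ?_) (mul_nonneg hk hk)
        gcongr

namespace IsMedianFn

section Algebra

variable {X : Type*} {μ : X → X → X → X}

lemma swap_right (hμ : IsMedianFn μ) (x y z : X) : μ x y z = μ x z y := hμ.1 x y z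

lemma rotate (hμ : IsMedianFn μ) (x y z : X) : μ x y z = μ y z x := hμ.2.1 x y z

lemma swap_left (hμ : IsMedianFn μ) (x y z : X) : μ x y z = μ y x z := by
  rw [hμ.rotate, hμ.swap_right]

lemma self_left (hμ : IsMedianFn μ) (x y : X) : μ x x y = x := hμ.2.2.1 x y

lemma self_right (hμ : IsMedianFn μ) (x y : X) : μ x y y = y := by
  rw [hμ.rotate, hμ.self_left]

lemma self_outer (hμ : IsMedianFn μ) (x y : X) : μ x y x = x := by
  rw [hμ.swap_right, hμ.self_left]

lemma distrib (hμ : IsMedianFn μ) (u v x y z : X) :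
    μ u v (μ x y z) = μ x (μ u v y) (μ u v z) := by
  rw [← hμ.rotate (μ x y z) u v, hμ.2.2.2, hμ.rotate y u v, hμ.rotate z u v]

lemma mem_interval (hμ : IsMedianFn μ) {x y a b c : X} (hb : μ x y b = b) (hc : μ x y c = c) :
    μ x y (μ a b c) = μ a b c := by
  rw [hμ.distrib, hb, hc]

lemma apply_mem_interval (hμ : IsMedianFn μ) (x y a : X) : μ x y (μ x y a) = μ x y a := by
  rw [← hμ.rotate a x y, hμ.distrib, hμ.self_outer, hμ.self_right]

/-- The interval from `x` to `y` as a distributive lattice with least element `x` and greatest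
element `y`. -/
abbrev intervalLattice (hμ : IsMedianFn μ) (x y : X) : DistribLattice {z : X // μ x y z = z} :=
  letI : Min {z : X // μ x y z = z} := ⟨fun a b => ⟨μ x a b, hμ.mem_interval a.2 b.2⟩⟩
  letI : Max {z : X // μ x y z = z} := ⟨fun a b => ⟨μ y a b, hμ.mem_interval a.2 b.2⟩⟩
  have assoc : ∀ u a b c, μ u (μ u a b) c = μ u a (μ u b c) := fun u a b c => by
    rw [hμ.swap_right u (μ u a b) c, hμ.rotate u a b, hμ.distrib, hμ.self_outer,
      hμ.swap_right u c b, hμ.rotate u a]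
  have absorb : ∀ u v a b, μ u v a = a → μ u a (μ v a b) = a := fun u v a b h => by
    rw [← hμ.rotate b v a, hμ.distrib, hμ.swap_right u a v, h, hμ.self_right u a,
      hμ.self_right]
  letI : Lattice {z : X // μ x y z = z} := Lattice.mk'
    (fun _ _ => Subtype.ext (hμ.swap_right _ _ _))
    (fun _ _ _ => Subtype.ext (assoc _ _ _ _))
    (fun _ _ => Subtype.ext (hμ.swap_right _ _ _))
    (fun _ _ _ => Subtype.ext (assoc _ _ _ _))
    (fun a _ => Subtype.ext (absorb _ _ _ _ (by rw [hμ.swap_left, a.2])))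
    (fun a _ => Subtype.ext (absorb _ _ _ _ a.2))
  DistribLattice.ofInfSupLe fun _ _ _ => le_of_eq (Subtype.ext (hμ.distrib _ _ _ _ _))

lemma le_iff (hμ : IsMedianFn μ) {x y : X} {a b : {z : X // μ x y z = z}} :
    letI := hμ.intervalLattice x y
    a ≤ b ↔ μ x a b = a := by
  let := hμ.intervalLattice x y
  exact inf_eq_left.symm.trans Subtype.ext_iff

lemma bot_le_interval (hμ : IsMedianFn μ) {x y : X} (a : {z : X // μ x y z = z}) :
    letI := hμ.intervalLattice x y
    ⟨x, hμ.self_outer x y⟩ ≤ a :=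
  hμ.le_iff.2 (hμ.self_left _ _)

lemma interval_le_top (hμ : IsMedianFn μ) {x y : X} (a : {z : X // μ x y z = z}) :
    letI := hμ.intervalLattice x y
    a ≤ ⟨y, hμ.self_right x y⟩ :=
  hμ.le_iff.2 ((hμ.swap_right _ _ _).trans a.2)

lemma coe_majority (hμ : IsMedianFn μ) {x y : X} (a b c : {z : X // μ x y z = z}) :
    letI := hμ.intervalLattice x y
    ((a ⊓ b ⊔ b ⊓ c ⊔ c ⊓ a : {z : X // μ x y z = z}) : X) = μ a b c := by
  let := hμ.intervalLattice x y
  have lower : ∀ a b c : {z : X // μ x y z = z},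
      a ⊓ b ≤ ⟨μ c a b, hμ.mem_interval a.2 b.2⟩ := fun a b c => by
    refine inf_eq_left.1 (Subtype.ext ?_)
    change μ x (a ⊓ b : {z : X // μ x y z = z}) (μ c a b) = _
    rw [hμ.distrib]
    change μ c (a ⊓ b ⊓ a : {z : X // μ x y z = z}) (a ⊓ b ⊓ b : {z : X // μ x y z = z}) = _
    rw [inf_eq_left.2 inf_le_left, inf_eq_left.2 inf_le_right, hμ.self_right]
  have upper : ∀ a b c : {z : X // μ x y z = z},
      ⟨μ c a b, hμ.mem_interval a.2 b.2⟩ ≤ a ⊔ b := fun a b c => by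
    refine sup_eq_left.1 (Subtype.ext ?_)
    change μ y (a ⊔ b : {z : X // μ x y z = z}) (μ c a b) = _
    rw [hμ.distrib]
    change μ c (a ⊔ b ⊔ a : {z : X // μ x y z = z}) (a ⊔ b ⊔ b : {z : X // μ x y z = z}) = _
    rw [sup_eq_left.2 le_sup_left, sup_eq_left.2 le_sup_right, hμ.self_right]
  let m : {z : X // μ x y z = z} := ⟨μ a b c, hμ.mem_interval b.2 c.2⟩
  have e1 : m = ⟨μ c a b, hμ.mem_interval a.2 b.2⟩ := Subtype.ext (hμ.rotate _ _ _).symm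
  have e2 : m = ⟨μ b c a, hμ.mem_interval c.2 a.2⟩ := Subtype.ext (hμ.rotate _ _ _)
  suffices a ⊓ b ⊔ b ⊓ c ⊔ c ⊓ a = m from congrArg Subtype.val this
  apply le_antisymm
  · exact sup_le (sup_le (e1 ▸ lower a b c) (lower b c a)) (e2 ▸ lower c a b)
  · have h : m ≤ (a ⊔ b) ⊓ ((b ⊔ c) ⊓ (c ⊔ a)) :=
      le_inf (e1 ▸ upper a b c) (le_inf (upper b c a) (e2 ▸ upper c a b))
    refine h.trans ?_
    rw [sup_comm b c, ← sup_inf_left, inf_sup_left]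
    refine sup_le ?_ ?_
    · rw [inf_sup_right]
      exact sup_le (le_sup_of_le_right (le_of_eq (inf_comm _ _)))
        (le_sup_of_le_left le_sup_right)
    · exact le_sup_of_le_left (le_sup_of_le_left
        (inf_le_right.trans (le_of_eq (inf_comm _ _))))

/-- Intervals of a median algebra of rank at most `n` contain no lattice `(n + 1)`-cubes. -/
lemma not_exists_cube (hμ : IsMedianFn μ) {n : ℕ} (hn : RankLE μ n) (x y : X) :
    letI := hμ.intervalLattice x y
    ¬ ∃ f : (Fin (n + 1) → Bool) → {z : X // μ x y z = z}, Function.Injective f ∧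
      (∀ u v, f (u ⊓ v) = f u ⊓ f v) ∧ ∀ u v, f (u ⊔ v) = f u ⊔ f v := by
  let := hμ.intervalLattice x y
  rintro ⟨f, hf, hinf, hsup⟩
  refine hn ⟨fun u => f u, Subtype.val_injective.comp hf, fun u v w => ?_⟩
  have : cubeMedian (n + 1) u v w = u ⊓ v ⊔ v ⊓ w ⊔ w ⊓ u := rfl
  change (f (cubeMedian (n + 1) u v w) : X) = μ (f u) (f v) (f w)
  rw [this, hsup, hsup, hinf, hinf, hinf, hμ.coe_majority]

/-- Distinct points of a finite subalgebra are separated by a halfspace. -/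
lemma exists_halfspace (hμ : IsMedianFn μ) {M : Set X} (hfin : M.Finite)
    (hM : IsSubalgebra μ M) {a b : X} (ha : a ∈ M) (hb : b ∈ M) (hab : a ≠ b) :
    ∃ h, IsHalfspaceIn μ M h ∧ a ∈ h ∧ b ∉ h := by
  let := hμ.intervalLattice a b
  let S : Set {z : X // μ a b z = z} := {e | (e : X) ∈ M ∧ (e : X) ≠ a}
  have hS : S.Finite :=
    (hfin.preimage Subtype.val_injective.injOn).subset fun e he => he.1
  obtain ⟨⟨e, he⟩, hmin⟩ := hS.exists_minimal
    ⟨⟨b, hμ.self_right a b⟩, hb, hab.symm⟩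
  have heM : e ∈ M := hmin.1.1
  have hea : e ≠ a := hmin.1.2
  have key : ∀ w ∈ M, μ a e w = a ∨ μ a e w = e := by
    intro w hw
    by_contra! h
    have hI : μ a b (μ a e w) = μ a e w := by
      rw [← hμ.rotate w a e]
      exact hμ.mem_interval (hμ.self_outer a b) he
    have hle : (⟨μ a e w, hI⟩ : {z : X // μ a b z = z}) ≤ ⟨e, he⟩ := by
      refine hμ.le_iff.2 ?_
      rw [hμ.swap_right]
      exact hμ.apply_mem_interval a e w
    have := hmin.2 (y := ⟨μ a e w, hI⟩) ⟨hM a ha e heM w hw, h.1⟩ hle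
    exact h.2 (congrArg Subtype.val (le_antisymm hle this))
  have conv : ∀ v p q z, μ a e p = v → μ a e q = v → μ p q z = z → μ a e z = v := by
    intro v p q z hp hq hz
    rw [← hz, ← hμ.rotate z p q, hμ.distrib, hp, hq, hμ.self_right]
  have hae : μ a e a = a := hμ.self_outer a e
  have hbe : μ a e b = e := by rw [hμ.swap_right, he]
  have hcompl : ∀ w ∈ M \ {w | w ∈ M ∧ μ a e w = a}, μ a e w = e := fun w hw =>
    (key w hw.1).resolve_left fun h => hw.2 ⟨hw.1, h⟩
  refine ⟨{w | w ∈ M ∧ μ a e w = a}, ⟨fun w hw => hw.1, ⟨a, ha, hae⟩,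
    ⟨b, hb, fun h => hea (hbe.symm.trans h.2)⟩, ?_, ?_⟩, ⟨ha, hae⟩,
    fun h => hea (hbe.symm.trans h.2)⟩
  · exact fun p hp q hq z hz hpq => ⟨hz, conv a p q z hp.2 hq.2 hpq⟩
  · refine fun p hp q hq z hz hpq => ⟨hz, fun h => hea ?_⟩
    exact (conv e p q z (hcompl p hp) (hcompl q hq) hpq).symm.trans h.2

/-- An edge crossing a wall is the gate image of the points on the two sides of the wall. -/
lemma gate_of_adjacent (hμ : IsMedianFn μ) {M h : Set X} (hfin : M.Finite)
    (hM : IsSubalgebra μ M) (hh : IsHalfspaceIn μ M h) {a b : X} (hab : AdjacentIn μ M a b)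
    (ha : a ∈ h) (hb : b ∈ M \ h) :
    (∀ u ∈ h, μ a b u = a) ∧ ∀ u ∈ M \ h, μ a b u = b := by
  obtain ⟨haM, hbM, h₀, -, huniq⟩ := hab
  have eq_h : ∀ g, IsHalfspaceIn μ M g → a ∈ g → b ∉ g → g = h := fun g hg hga hgb =>
    (huniq g ⟨hg, hga, hgb⟩).trans (huniq h ⟨hh, ha, hb.2⟩).symm
  have hmI : ∀ u, μ a b (μ a b u) = μ a b u := hμ.apply_mem_interval a b
  constructor
  · intro u hu
    have huM := hh.1 hu
    have hm := hM a haM b hbM u huM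
    have hmh : μ a b u ∈ h := hh.2.2.2.1 a ha u hu _ hm (by
      rw [hμ.swap_right a b u]; exact hμ.apply_mem_interval a u b)
    by_contra hne
    obtain ⟨g, hg, hag, hmg⟩ := hμ.exists_halfspace hfin hM haM hm (Ne.symm hne)
    have hbg : b ∉ g := fun hbg => hmg (hg.2.2.2.1 a hag b hbg _ hm (hmI u))
    exact hmg (eq_h g hg hag hbg ▸ hmh)
  · intro u hu
    have hm := hM a haM b hbM u hu.1
    have hmh : μ a b u ∉ h := (hh.2.2.2.2 b hb u hu _ hm (by
      rw [hμ.rotate a b u]; exact hμ.apply_mem_interval b u a)).2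
    by_contra hne
    obtain ⟨g, hg, hmg, hbg⟩ := hμ.exists_halfspace hfin hM hm hbM hne
    have hag : a ∈ g := by
      by_contra hag
      exact (hg.2.2.2.2 a ⟨haM, hag⟩ b ⟨hbM, hbg⟩ _ hm (hmI u)).2 hmg
    exact hmh (eq_h g hg hag hbg ▸ hmg)

/-- The points of a subalgebra in an interval are joined by a chain such that each step crosses
at most one wall. -/
lemma exists_chain (hμ : IsMedianFn μ) {M : Set X} (hfin : M.Finite) (hM : IsSubalgebra μ M)
    {x y : X} (hx : x ∈ M) (hy : y ∈ M) :
    ∃ (z : ℕ → {z : X // μ x y z = z}) (N : ℕ), (letI := hμ.intervalLattice x y; Monotone z) ∧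
      (z 0 : X) = x ∧ (z N : X) = y ∧ (∀ i, (z i : X) ∈ M) ∧
      ∀ i < N, ∀ h h', IsHalfspaceIn μ M h → IsHalfspaceIn μ M h' → (z i : X) ∈ h →
        (z i : X) ∈ h' → (z (i + 1) : X) ∉ h → (z (i + 1) : X) ∉ h' → h ⊆ h' := by
  let := hμ.intervalLattice x y
  let P := {w : {z : X // μ x y z = z} // (w : X) ∈ M}
  have : Finite P := (hfin.preimage Subtype.val_injective.injOn).to_subtype
  let bot : P := ⟨⟨x, hμ.self_outer x y⟩, hx⟩
  let top : P := ⟨⟨y, hμ.self_right x y⟩, hy⟩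
  obtain ⟨s, hs0, N, hsN, hcov⟩ := exists_covBy_seq_of_wellFoundedLT_wellFoundedGT_of_le
    (show bot ≤ top from hμ.interval_le_top _)
  refine ⟨fun i => (s (min i N)).1, N, ?_, ?_, ?_, fun i => (s (min i N)).2, ?_⟩
  · refine monotone_nat_of_le_succ fun i => ?_
    rcases lt_or_ge i N with h | h
    · rw [min_eq_left h.le, min_eq_left h]
      exact (hcov i h).le
    · rw [min_eq_right h, min_eq_right (h.trans (Nat.le_succ i))]
  · simp [hs0, bot]
  · simp [hsN, top]
  · intro i hi h h' hh hh' hzh hzh' hz'h hz'h' w hw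
    simp only [min_eq_left hi.le, min_eq_left (Nat.succ_le_of_lt hi)] at *
    by_contra hw'
    have hwM := hh.1 hw
    have hcov := hcov i hi
    have h1 := (hμ.le_iff (a := (s i).1) (b := (s (i + 1)).1)).1 hcov.le
    set u := s i
    set v := s (i + 1)
    have hmM : μ u.1 v.1 w ∈ M := hM _ u.2 _ v.2 _ hwM
    have hm : μ x y (μ u.1 v.1 w) = μ u.1 v.1 w := by
      rw [← hμ.rotate w u.1 v.1]
      exact hμ.mem_interval u.1.2 v.1.2
    let m : P := ⟨⟨_, hm⟩, hmM⟩
    have hmh : μ u.1 v.1 w ∈ h := hh.2.2.2.1 u.1 hzh w hw _ hmM (by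
      rw [hμ.swap_right u.1 v.1 w]; exact hμ.apply_mem_interval _ _ _)
    have hmh' : μ u.1 v.1 w ∉ h' := (hh'.2.2.2.2 v.1 ⟨v.2, hz'h'⟩ w ⟨hwM, hw'⟩ _ hmM (by
      rw [hμ.rotate u.1 v.1 w]; exact hμ.apply_mem_interval _ _ _)).2
    have hum : u ≤ m := hμ.le_iff.2 (by
      change μ x u.1 (μ u.1 v.1 w) = u.1
      rw [← hμ.rotate w u.1.1 v.1.1, hμ.distrib, hμ.self_right, h1, hμ.self_right])
    have hmv : m ≤ v := hμ.le_iff.2 (by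
      change μ x (μ u.1 v.1 w) v.1 = μ u.1 v.1 w
      rw [← hμ.rotate w u.1.1 v.1.1, hμ.swap_right, hμ.distrib, hμ.self_right,
        hμ.swap_right x, h1])
    rcases hum.lt_or_eq with h3 | h3
    · rcases hmv.lt_or_eq with h4 | h4
      · exact hcov.2 h3 h4
      · exact hz'h (h4 ▸ hmh)
    · exact hmh' (h3.subst (motive := fun p : P => (p.1 : X) ∈ h') hzh')

end Algebra

/-- The length of a chain in the interval from `x` to `y` is controlled by `dist x y`. -/
lemma sum_dist_le {X : Type*} [MetricSpace X] {μ : X → X → X → X} (hμ : IsMedianFn μ)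
    {n : ℕ} (hn : RankLE μ n) {k l : ℝ} (hk : 0 ≤ k) (hl : 0 ≤ l)
    (hlip : ∀ a b c c' : X, dist (μ a b c) (μ a b c') ≤ k * dist c c') {x y : X}
    {c : ℝ → X} (hc : LipschitzOnWith l.toNNReal c (Set.Icc 0 (dist x y))) (hc0 : c 0 = x)
    (hc1 : c (dist x y) = y) (z : ℕ → {z : X // μ x y z = z})
    (hz : letI := hμ.intervalLattice x y; Monotone z) (N : ℕ) :
    ∑ i ∈ Finset.range N, dist (z i) (z (i + 1)) ≤ 2 * n * k ^ 4 * l * dist x y := by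
  let := hμ.intervalLattice x y
  let : OrderBot {z : X // μ x y z = z} :=
    { bot := ⟨x, hμ.self_outer x y⟩, bot_le := hμ.bot_le_interval }
  set D := dist x y with hD
  have hD0 : 0 ≤ D := dist_nonneg
  let C := k * (k * (l * D))
  have hC : 0 ≤ C := by positivity
  have main : ∀ T : ℕ, 1 ≤ T → ∑ i ∈ Finset.range N, dist (z i) (z (i + 1)) ≤
      k * k * (n * (N * (C / T) + 2 * C)) := by
    intro T hT
    have hT0 : (0 : ℝ) < T := by exact_mod_cast hT
    let p : ℕ → {z : X // μ x y z = z} := fun t => ⟨μ x y (c (t * (D / T))),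
      hμ.apply_mem_interval _ _ _⟩
    have hp : ∀ t < T, dist (p t) (p (t + 1)) ≤ k * (l * (D / T)) := by
      intro t ht
      have hmem : ∀ s : ℕ, s ≤ T → (s : ℝ) * (D / T) ∈ Set.Icc 0 D := fun s hs => by
        refine ⟨by positivity, ?_⟩
        have : (s : ℝ) ≤ T := by exact_mod_cast hs
        calc (s : ℝ) * (D / T) ≤ T * (D / T) := by gcongr
          _ = D := by field_simp
      refine (hlip _ _ _ _).trans (mul_le_mul_of_nonneg_left ?_ hk)
      refine (hc.dist_le_mul _ (hmem t ht.le) _ (hmem (t + 1) ht)).trans (le_of_eq ?_)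
      rw [Real.coe_toNNReal l hl, Real.dist_eq]
      push_cast
      rw [← sub_mul, sub_add_cancel_left, abs_mul, abs_neg, abs_one, one_mul,
        abs_of_nonneg (by positivity)]
    let q : ℕ → {z : X // μ x y z = z} := partialSups p
    have hq : ∀ t < T, dist (q t) (q (t + 1)) ≤ C / T := by
      intro t ht
      have h1 : q (t + 1) = q t ⊔ p (t + 1) := partialSups_add_one p t
      have h2 : q t = q t ⊔ p t := (sup_eq_left.2 (le_partialSups p t)).symm
      rw [h1]
      nth_rw 1 [h2]
      refine (hlip y _ _ _).trans ((mul_le_mul_of_nonneg_left (hp t ht) hk).trans (le_of_eq ?_))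
      simp only [C]
      ring
    have h0 : q 0 ≤ z 0 := by
      have : q 0 = ⊥ := by
        refine Subtype.ext ?_
        change μ x y (c ((0 : ℕ) * (D / T))) = x
        rw [Nat.cast_zero, zero_mul, hc0, hμ.self_outer]
      rw [this]
      exact bot_le
    have hTop : z N ≤ q T := by
      refine (hμ.interval_le_top _).trans ((le_of_eq ?_).trans (le_partialSups p T))
      refine Subtype.ext ?_
      change y = μ x y (c (T * (D / T)))
      rw [mul_div_cancel₀ D hT0.ne', hc1, hμ.self_right]
    have := sum_dist_chain_le n k hk (fun a b c => hlip x _ _ _) (fun a b c => hlip y _ _ _)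
      (hμ.not_exists_cube hn x y) z q hz (partialSups p).monotone N T h0 hTop (C / T)
      (by positivity) hq
    rwa [mul_div_cancel₀ C hT0.ne'] at this
  have hlim : Filter.Tendsto (fun T : ℕ => k * k * (n * (N * (C / T) + 2 * C))) Filter.atTop
      (nhds (k * k * (n * (N * 0 + 2 * C)))) :=
    ((((tendsto_const_div_atTop_nhds_zero_nat C).const_mul _).add_const _).const_mul _).const_mul _
  refine (ge_of_tendsto hlim (Filter.eventually_atTop.2 ⟨1, main⟩)).trans (le_of_eq ?_)
  simp only [C]
  ring

/-- The total length of the walls of a finite subalgebra separating `x` from `y` is controlled by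
`dist x y`. -/
lemma dmuM_le {X : Type*} [MetricSpace X] {μ : X → X → X → X} (hμ : IsMedianFn μ)
    {n : ℕ} (hn : RankLE μ n) {k l : ℝ} (hk : 0 ≤ k) (hl : 0 ≤ l)
    (hlip : ∀ a b c c' : X, dist (μ a b c) (μ a b c') ≤ k * dist c c') {x y : X}
    {c : ℝ → X} (hc : LipschitzOnWith l.toNNReal c (Set.Icc 0 (dist x y))) (hc0 : c 0 = x)
    (hc1 : c (dist x y) = y) {M : Set X} (hfin : M.Finite) (hM : IsSubalgebra μ M) :
    dmuM μ M x y ≤ 2 * n * k ^ 5 * l * dist x y := by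
  classical
  let S : Set (Set X) := {h | IsHalfspaceIn μ M h ∧ x ∈ h ∧ y ∈ M \ h}
  have hSfin : S.Finite := hfin.finite_subsets.subset fun h hh => hh.1.1
  rcases S.eq_empty_or_nonempty with hS | ⟨h₀, hh₀, hx₀, hy₀⟩
  · have : dmuM μ M x y = 0 := by
      change ∑ᶠ h ∈ S, lamMax μ M h = 0
      rw [hS, finsum_mem_empty]
    rw [this]
    positivity
  obtain ⟨z, N, hz, hz0, hzN, hzM, hcross⟩ := hμ.exists_chain hfin hM (hh₀.1 hx₀) hy₀.1
  have hexists : ∀ h ∈ S, ∃ i < N, (z i : X) ∈ h ∧ (z (i + 1) : X) ∉ h := by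
    intro h hh
    by_contra! hstay
    have : ∀ i ≤ N, (z i : X) ∈ h := by
      intro i
      induction i with
      | zero => exact fun _ => hz0.symm.subst (motive := (· ∈ h)) hh.2.1
      | succ i ih => exact fun hi => hstay i hi (ih (Nat.le_of_succ_le hi))
    exact hh.2.2.2 (hzN.subst (motive := (· ∈ h)) (this N le_rfl))
  choose! e heN hein heout using hexists
  have hinj : Set.InjOn e S := by
    intro h hh h' hh' heq
    have h1 := hein h' hh'
    have h2 := heout h' hh'
    rw [← heq] at h1 h2
    exact (hcross _ (heN h hh) h h' hh.1 hh'.1 (hein h hh) h1 (heout h hh) h2).antisymm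
      (hcross _ (heN h hh) h' h hh'.1 hh.1 h1 (hein h hh) h2 (heout h hh))
  have hlam : ∀ h ∈ S, lamMax μ M h ≤ k * dist (z (e h)) (z (e h + 1)) := by
    intro h hh
    refine Real.sSup_le ?_ (by positivity)
    rintro r ⟨a, b, hab, ha, hb, rfl⟩
    obtain ⟨hga, hgb⟩ := hμ.gate_of_adjacent hfin hM hh.1 hab ha hb
    have := hlip a b (z (e h)) (z (e h + 1))
    rwa [hga _ (hein h hh), hgb _ ⟨hzM _, heout h hh⟩] at this
  calc dmuM μ M x y = ∑ h ∈ hSfin.toFinset, lamMax μ M h :=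
        finsum_mem_eq_finite_toFinset_sum _ hSfin
    _ ≤ ∑ h ∈ hSfin.toFinset, k * dist (z (e h)) (z (e h + 1)) :=
        Finset.sum_le_sum fun h hh => hlam h (hSfin.mem_toFinset.1 hh)
    _ = ∑ i ∈ hSfin.toFinset.image e, k * dist (z i) (z (i + 1)) :=
        (Finset.sum_image (f := fun i => k * dist (z i) (z (i + 1)))
          (by simpa using hinj)).symm
    _ ≤ ∑ i ∈ Finset.range N, k * dist (z i) (z (i + 1)) := by
        refine Finset.sum_le_sum_of_subset_of_nonneg ?_ fun i _ _ => by positivity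
        intro i hi
        obtain ⟨h, hh, rfl⟩ := Finset.mem_image.1 hi
        exact Finset.mem_range.2 (heN h (hSfin.mem_toFinset.1 hh))
    _ = k * ∑ i ∈ Finset.range N, dist (z i) (z (i + 1)) := by rw [Finset.mul_sum]
    _ ≤ k * (2 * n * k ^ 4 * l * dist x y) :=
        mul_le_mul_of_nonneg_left (hμ.sum_dist_le hn hk hl hlip hc hc0 hc1 z hz N) hk
    _ = 2 * n * k ^ 5 * l * dist x y := by ring

end IsMedianFn

/-- For all `n ∈ ℕ`, `k > 0` and `l ≥ 1` there is `L ≥ 0` such that every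
metric median algebra `(X, d, μ)` of rank at most `n` in which the median is `k`-Lipschitz
in the third variable and any two points are joined by an `l`-Lipschitz path defined on
`[0, d(x,y)]` is uniformly rectifiable with constant `L`: `d_μ(x,y) ≤ L·d(x,y)`
(equivalently, `d_μ^M(x,y) ≤ L·d(x,y)` for every finite subalgebra `M`). -/
theorem stmt_6 (n : ℕ) (k l : ℝ) (hk : 0 < k) (hl : 1 ≤ l) :
    ∃ L : ℝ, 0 ≤ L ∧
      ∀ (X : Type u) [MetricSpace X] (μ : X → X → X → X),
        IsMedianFn μ →
        (Continuous fun p : X × X × X => μ p.1 p.2.1 p.2.2) →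
        RankLE μ n →
        (∀ a b c c' : X, dist (μ a b c) (μ a b c') ≤ k * dist c c') →
        (∀ x y : X, ∃ c : ℝ → X,
          LipschitzOnWith l.toNNReal c (Set.Icc 0 (dist x y)) ∧ c 0 = x ∧ c (dist x y) = y) →
        ∀ M : Set X, M.Finite → IsSubalgebra μ M →
          ∀ x y : X, dmuM μ M x y ≤ L * dist x y := by
  refine ⟨2 * n * k ^ 5 * l, by positivity, ?_⟩
  intro X _ μ hμ _ hn hlip hpath M hfin hM x y
  obtain ⟨c, hc, hc0, hc1⟩ := hpath x y
  exact hμ.dmuM_le hn hk.le (zero_le_one.trans hl) hlip hc hc0 hc1 hfin hM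
end

section
/- Let a group G act by isometries on a complete, connected median metric space (X, d) whose intrinsic median algebra (X, μ_d) has rank at most n for some n ∈ ℕ. Then the action has a fixed point if and only if it has bounded orbits. -/
open Set

/-- `z` lies in the metric interval between `x` and `y`. -/
def Between {X : Type*} [MetricSpace X] (x z y : X) : Prop :=
  dist x z + dist z y = dist x y

/-- `μ` is the median operation of a median metric space. -/
structure IsMedianOp {X : Type*} [MetricSpace X] (μ : X → X → X → X) : Prop where
  btw₁₂ : ∀ x y z, Between x (μ x y z) y
  btw₂₃ : ∀ x y z, Between y (μ x y z) z
  btw₁₃ : ∀ x y z, Between x (μ x y z) z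
  uniq : ∀ x y z w, Between x w y → Between y w z → Between x w z → w = μ x y z

/-- A set is convex if it contains the metric interval between any two of its points. -/
def MedConvex {X : Type*} [MetricSpace X] (C : Set X) : Prop :=
  ∀ ⦃x⦄, x ∈ C → ∀ ⦃y⦄, y ∈ C → ∀ ⦃z⦄, Between x z y → z ∈ C

/-- `p` is the gate of `x` in `C`. -/
def IsGate {X : Type*} [MetricSpace X] (C : Set X) (x p : X) : Prop :=
  p ∈ C ∧ ∀ c ∈ C, Between x p c

section Between

variable {X : Type*} [MetricSpace X] {a b c w x y z : X}

lemma Between.symm (h : Between x z y) : Between y z x := by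
  unfold Between at *
  rw [dist_comm y z, dist_comm z x, dist_comm y x]; linarith

lemma between_left (x y : X) : Between x x y := by simp [Between]

lemma between_right (x y : X) : Between x y y := by simp [Between]

/-- If `a, c, b` and `a, w, c` are aligned then `a, w, b` are aligned. -/
lemma Between.trans_left (h : Between a c b) (h' : Between a w c) : Between a w b := by
  unfold Between at *
  have h₁ := dist_triangle a w b
  have h₂ := dist_triangle w c b
  linarith

/-- If `a, c, b` and `a, w, c` are aligned then `w, c, b` are aligned. -/
lemma Between.trans_right (h : Between a c b) (h' : Between a w c) : Between w c b := by
  unfold Between at *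
  have h₁ := dist_triangle a w b
  have h₂ := dist_triangle w c b
  linarith

/-- If `a, w, b` and `w, c, b` are aligned then `a, w, c` are aligned. -/
lemma Between.left_of_right (h : Between a w b) (h' : Between w c b) : Between a w c :=
  (h.symm.trans_right h'.symm).symm

/-- If `a, w, b` and `w, c, b` are aligned then `a, c, b` are aligned. -/
lemma Between.trans_left' (h : Between a w b) (h' : Between w c b) : Between a c b :=
  (h.symm.trans_left h'.symm).symm

lemma Between.eq_of_between_of_between (h : Between a y b) (h₁ : Between a w y)
    (h₂ : Between y w b) : w = y := by
  unfold Between at *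
  have h₃ := dist_triangle a w b
  rw [dist_comm y w] at h₂
  exact dist_le_zero.1 (by linarith)

lemma Between.antisymm (h : Between a x y) (h' : Between a y x) : x = y := by
  unfold Between at *
  rw [dist_comm y x] at h'
  exact dist_le_zero.1 (by linarith)

lemma Between.eq_of_self (h : Between x z x) : z = x := by
  unfold Between at h
  rw [dist_comm z x, dist_self] at h
  exact (dist_le_zero.1 (by linarith)).symm

lemma isClosed_setOf_between (x y : X) : IsClosed {z | Between x z y} :=
  isClosed_eq (by fun_prop) continuous_const

lemma Isometry.between {f : X → X} (hf : Isometry f) (h : Between x z y) :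
    Between (f x) (f z) (f y) := by
  unfold Between at *
  rwa [hf.dist_eq, hf.dist_eq, hf.dist_eq]

end Between

namespace IsGate

variable {X : Type*} [MetricSpace X] {C : Set X} {x y p q : X}

lemma dist_le (hp : IsGate C x p) (hq : IsGate C y q) : dist p q ≤ dist x y := by
  have h₁ := hp.2 q hq.1
  have h₂ := hq.2 p hp.1
  unfold Between at *
  have h₃ := dist_triangle x y q
  have h₄ := dist_triangle y x p
  rw [dist_comm y x] at h₄
  rw [dist_comm q p] at h₂
  linarith

end IsGate

namespace IsMedianOp

variable {X : Type*} [MetricSpace X] {μ : X → X → X → X}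

lemma comm₁₂ (hμ : IsMedianOp μ) (x y z : X) : μ x y z = μ y x z :=
  hμ.uniq _ _ _ _ (hμ.btw₁₂ x y z).symm (hμ.btw₁₃ x y z) (hμ.btw₂₃ x y z)

lemma comm₂₃ (hμ : IsMedianOp μ) (x y z : X) : μ x y z = μ x z y :=
  hμ.uniq _ _ _ _ (hμ.btw₁₃ x y z) (hμ.btw₂₃ x y z).symm (hμ.btw₁₂ x y z)

lemma eq_of_between (hμ : IsMedianOp μ) {x y z : X} (h : Between x z y) : μ x y z = z :=
  (hμ.uniq _ _ _ _ h (between_right _ _) (between_right _ _)).symm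

/-- With respect to the base point `c`, the median is a greatest lower bound. -/
lemma between_of_lower (hμ : IsMedianOp μ) {c w x y : X} (hx : Between c w x)
    (hy : Between c w y) : Between c w (μ x y c) := by
  have h₁ : Between c (μ x y w) x := hx.trans_left' (hμ.btw₁₃ x y w).symm
  have h₂ : Between c (μ x y w) y := hy.trans_left' (hμ.btw₂₃ x y w).symm
  rw [← hμ.uniq x y c _ (hμ.btw₁₂ x y w) h₂.symm h₁.symm]
  exact hx.left_of_right (hμ.btw₁₃ x y w).symm

lemma meet_eq_of_between (hμ : IsMedianOp μ) {a b c : X} (hc : Between a c b) (x : X) :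
    μ c x a = μ c (μ a b x) a := by
  have hy : Between a (μ a b x) x := hμ.btw₁₃ a b x
  have h₁ : Between a (μ c x a) b := hc.trans_left (hμ.btw₁₃ c x a).symm
  have h₂ : Between a (μ c x a) (μ a b x) := by
    have := hμ.between_of_lower h₁ (hμ.btw₂₃ c x a).symm
    rwa [hμ.comm₂₃ b, hμ.comm₁₂ b] at this
  have h₃ := hμ.between_of_lower (hμ.btw₁₃ c x a).symm h₂
  have h₄ := hμ.between_of_lower (hμ.btw₁₃ c (μ a b x) a).symm
    (hy.trans_left (hμ.btw₂₃ c (μ a b x) a).symm)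
  exact h₃.antisymm h₄

/-- The median is the gate of a point in an interval. -/
lemma isGate_interval (hμ : IsMedianOp μ) (a b x : X) :
    IsGate {z | Between a z b} x (μ a b x) := by
  refine ⟨hμ.btw₁₂ a b x, fun c hc => ?_⟩
  have key : ∀ a b, Between a c b → Between a (μ x (μ a b x) c) (μ a b x) := by
    intro a b hc
    have hp : Between c (μ c x a) (μ x (μ a b x) c) := by
      refine hμ.between_of_lower (hμ.btw₁₂ c x a) ?_
      rw [hμ.meet_eq_of_between hc]
      exact hμ.btw₁₂ _ _ _
    have hw := (hμ.btw₂₃ x (μ a b x) c).symm.trans_right hp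
    refine Between.trans_left' ?_ hw
    rw [hμ.meet_eq_of_between hc]
    exact (hμ.btw₂₃ _ _ _).symm
  have h₁ := key a b hc
  have h₂ := key b a hc.symm
  rw [hμ.comm₁₂ b a] at h₂
  have h := (hμ.btw₁₂ a b x).eq_of_between_of_between h₁ h₂.symm
  exact h ▸ hμ.btw₁₃ x (μ a b x) c

lemma medConvex_interval (hμ : IsMedianOp μ) (a b : X) : MedConvex {z | Between a z b} := by
  intro c hc d hd x hx
  have hg := hμ.isGate_interval a b x
  have h := hx.eq_of_between_of_between (hg.2 c hc).symm (hg.2 d hd)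
  exact h ▸ hg.1

lemma dist_median_le (hμ : IsMedianOp μ) (a b x y : X) :
    dist (μ a b x) (μ a b y) ≤ dist x y :=
  (hμ.isGate_interval a b x).dist_le (hμ.isGate_interval a b y)

lemma continuous_median (hμ : IsMedianOp μ) (a b : X) : Continuous (μ a b) :=
  (LipschitzWith.of_dist_le_mul (K := 1) (by simpa using hμ.dist_median_le a b)).continuous

/-- Gate maps preserve betweenness. -/
lemma between_gate (hμ : IsMedianOp μ) {C : Set X} (hC : MedConvex C) {x y m p q c : X}
    (hp : IsGate C x p) (hq : IsGate C y q) (hc : IsGate C m c) (h : Between x m y) :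
    Between p c q := by
  set u := μ p q c
  have hu : u ∈ C := hC hp.1 hq.1 (hμ.btw₁₂ p q c)
  have hxu : Between c u x := (hp.2 c hc.1).symm.trans_left (hμ.btw₁₃ p q c).symm
  have hyu : Between c u y := (hq.2 c hc.1).symm.trans_left (hμ.btw₂₃ p q c).symm
  have h₁ : Between c u (μ x y c) := hμ.between_of_lower hxu hyu
  have h₂ : Between c (μ x y c) m := (hμ.isGate_interval x y c).2 m h
  have h₃ : Between m u c := (h₂.trans_left h₁).symm
  have h₄ : u = c := h₃.antisymm (hc.2 u hu)
  exact h₄ ▸ hμ.btw₁₂ p q c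

/-- Gate maps are median homomorphisms. -/
lemma gate_median (hμ : IsMedianOp μ) {C : Set X} (hC : MedConvex C) {x y z p q r c : X}
    (hp : IsGate C x p) (hq : IsGate C y q) (hr : IsGate C z r) (hc : IsGate C (μ x y z) c) :
    c = μ p q r :=
  hμ.uniq _ _ _ _ (hμ.between_gate hC hp hq hc (hμ.btw₁₂ x y z))
    (hμ.between_gate hC hq hr hc (hμ.btw₂₃ x y z))
    (hμ.between_gate hC hp hr hc (hμ.btw₁₃ x y z))

lemma between_median (hμ : IsMedianOp μ) (a b : X) {x y z : X} (h : Between x z y) :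
    Between (μ a b x) (μ a b z) (μ a b y) :=
  hμ.between_gate (hμ.medConvex_interval a b) (hμ.isGate_interval a b x)
    (hμ.isGate_interval a b y) (hμ.isGate_interval a b z) h

/-- The median of two points of `C` and `w` only depends on the gate of `w` in `C`. -/
lemma median_gate (hμ : IsMedianOp μ) {C : Set X} (hC : MedConvex C) {x y w p : X}
    (hx : x ∈ C) (hy : y ∈ C) (hp : IsGate C w p) : μ x y w = μ x y p := by
  have hm : Between w p (μ x y w) := hp.2 _ (hC hx hy (hμ.btw₁₂ x y w))
  exact hμ.uniq _ _ _ _ (hμ.btw₁₂ x y w) ((hμ.btw₂₃ x y w).symm.trans_right hm).symm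
    ((hμ.btw₁₃ x y w).symm.trans_right hm).symm

lemma medConvex_preimage (hμ : IsMedianOp μ) {U : Set X} (hU : MedConvex U) (a b : X) :
    MedConvex (μ a b ⁻¹' U) :=
  fun _ hx _ hy _ hz => hU hx hy (hμ.between_median a b hz)

lemma medConvex_closure (hμ : IsMedianOp μ) {U : Set X} (hU : MedConvex U) :
    MedConvex (closure U) := by
  intro x hx y hy z hz
  rw [Metric.mem_closure_iff] at *
  intro ε hε
  obtain ⟨x', hx', hxx⟩ := hx (ε / 2) (by positivity)
  obtain ⟨y', hy', hyy⟩ := hy (ε / 2) (by positivity)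
  refine ⟨μ x' y' z, hU hx' hy' (hμ.btw₁₂ _ _ _), ?_⟩
  have h₁ := hμ.dist_median_le y z x x'
  have h₂ := hμ.dist_median_le x' z y y'
  have h₃ := hμ.eq_of_between hz
  have e₁ : μ y z x = z := by rw [hμ.comm₂₃, hμ.comm₁₂, h₃]
  have e₂ : μ y z x' = μ x' y z := by rw [hμ.comm₂₃, hμ.comm₁₂]
  rw [e₁, e₂] at h₁
  rw [hμ.comm₂₃ x' z, hμ.comm₂₃ x' z] at h₂
  linarith [dist_triangle z (μ x' y z) (μ x' y' z)]

lemma isClosed_interval_preimage (hμ : IsMedianOp μ) {U : Set X} (hU : IsClosed U) (a b : X) :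
    IsClosed (μ a b ⁻¹' U) :=
  hU.preimage (hμ.continuous_median a b)

end IsMedianOp

/-- Projecting back and forth between two sets stabilises after two steps. -/
lemma IsGate.eq_of_isGate {X : Type*} [MetricSpace X] {A B : Set X} {a b a' b' : X} (ha : a ∈ A)
    (hb : IsGate B a b) (ha' : IsGate A b a') (hb' : IsGate B a' b') : b' = b :=
  ((ha'.2 a ha).symm.trans_left' (hb'.2 b hb.1)).antisymm (hb.2 b' hb'.1)

section Complete

variable {X : Type*} [MetricSpace X] [CompleteSpace X]

/-- A downward directed family of nonempty closed sets of arbitrarily small diameter has a common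
point. -/
lemma exists_forall_mem_of_directed {ι : Type*} [Nonempty ι] (K : ι → Set X)
    (hdir : Directed (· ≥ ·) K) (hne : ∀ i, (K i).Nonempty) (hcl : ∀ i, IsClosed (K i))
    (hdiam : ∀ ε > 0, ∃ i, ∀ x ∈ K i, ∀ y ∈ K i, dist x y < ε) : ∃ p, ∀ i, p ∈ K i := by
  have hdir' : Directed (· ≥ ·) fun i => Filter.principal (K i) :=
    fun i j => (hdir i j).imp fun k hk => ⟨Filter.principal_mono.2 hk.1, Filter.principal_mono.2 hk.2⟩
  have hF : (⨅ i, Filter.principal (K i)).NeBot :=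
    Filter.iInf_neBot_of_directed' hdir' fun i => Filter.principal_neBot_iff.2 (hne i)
  have hmem : ∀ i, K i ∈ ⨅ i, Filter.principal (K i) := fun i =>
    Filter.mem_iInf_of_mem i (Filter.mem_principal_self _)
  have hC : Cauchy (⨅ i, Filter.principal (K i)) :=
    Metric.cauchy_iff.2 ⟨hF, fun ε hε => (hdiam ε hε).imp' K fun i hi => ⟨hmem i, hi⟩⟩
  obtain ⟨p, hp⟩ := CompleteSpace.complete hC
  exact ⟨p, fun i => (hcl i).closure_subset
    (mem_closure_iff_clusterPt.2 ((ClusterPt.of_le_nhds hp).mono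
      (Filter.le_principal_iff.2 (hmem i))))⟩

namespace IsMedianOp

variable {μ : X → X → X → X}

lemma exists_isGate (hμ : IsMedianOp μ) {C : Set X} (hC : MedConvex C) (hcl : IsClosed C)
    (hne : C.Nonempty) (x : X) : ∃ p, IsGate C x p := by
  have hinf : ∀ c ∈ C, Metric.infDist x C ≤ dist x c := fun c hc => Metric.infDist_le_dist_of_mem hc
  have : Nonempty {ε : ℝ // 0 < ε} := ⟨⟨1, one_pos⟩⟩
  suffices h : ∃ p, ∀ ε : {ε : ℝ // 0 < ε},
      p ∈ C ∩ Metric.closedBall x (Metric.infDist x C + ε) by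
    obtain ⟨p, hp⟩ := h
    have hpC : p ∈ C := (hp ⟨1, one_pos⟩).1
    have hpx : dist x p ≤ Metric.infDist x C := by
      refine le_of_forall_pos_le_add fun ε hε => ?_
      rw [dist_comm]
      exact (hp ⟨ε, hε⟩).2
    refine ⟨p, hpC, fun c hc => ?_⟩
    have h₁ : Between x (μ x p c) p := hμ.btw₁₂ x p c
    have h₂ := hinf _ (hC hpC hc (hμ.btw₂₃ x p c))
    have h₃ : μ x p c = p := by
      unfold Between at h₁
      exact dist_le_zero.1 (by linarith)
    exact h₃ ▸ hμ.btw₁₃ x p c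
  refine _root_.exists_forall_mem_of_directed _ ?_ ?_ ?_ ?_
  · intro a b
    refine ⟨⟨min a b, lt_min a.2 b.2⟩, ?_, ?_⟩
    · refine inter_subset_inter_right _ (Metric.closedBall_subset_closedBall ?_)
      simp
    · refine inter_subset_inter_right _ (Metric.closedBall_subset_closedBall ?_)
      simp
  · rintro ⟨ε, hε⟩
    obtain ⟨c, hc, h⟩ := (Metric.infDist_lt_iff hne).1 (lt_add_of_pos_right (Metric.infDist x C) hε)
    exact ⟨c, hc, by rw [Metric.mem_closedBall, dist_comm]; exact h.le⟩
  · exact fun ε => hcl.inter Metric.isClosed_closedBall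
  · intro ε hε
    refine ⟨⟨ε / 3, by positivity⟩, fun y hy z hz => ?_⟩
    have hy' := Metric.mem_closedBall.1 hy.2
    have hz' := Metric.mem_closedBall.1 hz.2
    rw [dist_comm] at hy' hz'
    have h₁ := hinf _ (hC hy.1 hz.1 (hμ.btw₂₃ x y z))
    have h₂ := hμ.btw₁₂ x y z
    have h₃ := hμ.btw₁₃ x y z
    have h₄ := hμ.btw₂₃ x y z
    unfold Between at *
    rw [dist_comm y] at h₄
    simp only at hy' hz'
    linarith

/-- A downward directed family of nonempty closed convex subsets of a bounded set has a common
point. -/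
lemma exists_forall_mem_of_directed (hμ : IsMedianOp μ) {ι : Type*} [Nonempty ι] (K : ι → Set X)
    (hdir : Directed (· ≥ ·) K) (hne : ∀ i, (K i).Nonempty) (hcl : ∀ i, IsClosed (K i))
    (hconv : ∀ i, MedConvex (K i)) {C : Set X} (hC : Bornology.IsBounded C)
    (hsub : ∀ i, K i ⊆ C) : ∃ p, ∀ i, p ∈ K i := by
  obtain ⟨i₀⟩ := ‹Nonempty ι›
  obtain ⟨x, -⟩ := hne i₀
  choose π hπ using fun i => hμ.exists_isGate (hconv i) (hcl i) (hne i) x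
  obtain ⟨R, hR⟩ := hC.subset_closedBall x
  have hbdd : BddAbove (range fun i => dist x (π i)) := by
    refine ⟨R, ?_⟩
    rintro _ ⟨i, rfl⟩
    exact (dist_comm _ _).trans_le <| hR (hsub i (hπ i).1)
  set s := ⨆ i, dist x (π i)
  have hs : ∀ i, dist x (π i) ≤ s := fun i => le_ciSup hbdd i
  have : Nonempty ι := ⟨i₀⟩
  suffices h : ∃ p, ∀ i, p ∈ K i ∩ Metric.closedBall x s from h.imp fun p hp i => (hp i).1
  refine _root_.exists_forall_mem_of_directed _ ?_ ?_ ?_ ?_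
  · intro i j
    obtain ⟨k, hi, hj⟩ := hdir i j
    exact ⟨k, inter_subset_inter_left _ hi, inter_subset_inter_left _ hj⟩
  · exact fun i => ⟨π i, (hπ i).1, by rw [Metric.mem_closedBall, dist_comm]; exact hs i⟩
  · exact fun i => (hcl i).inter Metric.isClosed_closedBall
  · intro ε hε
    obtain ⟨i, hi⟩ := exists_lt_of_lt_ciSup (show s - ε / 2 < s by linarith)
    refine ⟨i, fun y hy z hz => ?_⟩
    have hy' := Metric.mem_closedBall.1 hy.2
    have hz' := Metric.mem_closedBall.1 hz.2
    rw [dist_comm] at hy' hz'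
    have h₁ := (hπ i).2 y hy.1
    have h₂ := (hπ i).2 z hz.1
    unfold Between at *
    linarith [dist_triangle_left y z (π i)]

end IsMedianOp

end Complete

lemma MedConvex.inter {X : Type*} [MetricSpace X] {A B : Set X} (hA : MedConvex A)
    (hB : MedConvex B) : MedConvex (A ∩ B) :=
  fun _ hx _ hy _ hz => ⟨hA hx.1 hy.1 hz, hB hx.2 hy.2 hz⟩

lemma MedConvex.sInter {X : Type*} [MetricSpace X] {F : Set (Set X)}
    (hF : ∀ A ∈ F, MedConvex A) : MedConvex (⋂₀ F) :=
  fun _ hx _ hy _ hz A hA => hF A hA (hx A hA) (hy A hA) hz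

namespace IsMedianOp

variable {X : Type*} [MetricSpace X] {μ : X → X → X → X}

lemma helly_three (hμ : IsMedianOp μ) {A B C : Set X} (hA : MedConvex A) (hB : MedConvex B)
    (hC : MedConvex C) (hAB : (A ∩ B).Nonempty) (hAC : (A ∩ C).Nonempty)
    (hBC : (B ∩ C).Nonempty) : ((A ∩ B) ∩ C).Nonempty := by
  obtain ⟨x, hxA, hxB⟩ := hAB
  obtain ⟨y, hyA, hyC⟩ := hAC
  obtain ⟨z, hzB, hzC⟩ := hBC
  exact ⟨μ x y z, ⟨hA hxA hyA (hμ.btw₁₂ x y z), hB hxB hzB (hμ.btw₁₃ x y z)⟩,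
    hC hyC hzC (hμ.btw₂₃ x y z)⟩

/-- Helly property: finitely many pairwise intersecting convex sets, all of which meet the convex
set `C`, have a common point in `C`. -/
lemma helly_finset (hμ : IsMedianOp μ) (s : Finset (Set X)) (hs : ∀ A ∈ s, MedConvex A)
    (hp : ∀ A ∈ s, ∀ B ∈ s, (A ∩ B).Nonempty) {C : Set X} (hC : MedConvex C)
    (hne : C.Nonempty) (hCs : ∀ A ∈ s, (C ∩ A).Nonempty) :
    (C ∩ ⋂₀ (s : Set (Set X))).Nonempty := by
  classical
  induction s using Finset.induction_on generalizing C with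
  | empty => simpa using hne
  | insert A s _ ih =>
    simp only [Finset.mem_insert, forall_eq_or_imp] at hs hp hCs
    have := ih hs.2 (fun B hB D hD => (hp.2 B hB).2 D hD) (hC.inter hs.1) hCs.1
      fun B hB => hμ.helly_three hC hs.1 (hs.2 B hB) hCs.1 (hCs.2 B hB) (hp.1.2 B hB)
    rwa [Finset.coe_insert, sInter_insert, ← inter_assoc]

/-- Helly property for arbitrary families of pairwise intersecting closed convex subsets of a
bounded set. -/
lemma helly (hμ : IsMedianOp μ) [CompleteSpace X] {F : Set (Set X)} (hF : F.Nonempty)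
    (hconv : ∀ A ∈ F, MedConvex A) (hcl : ∀ A ∈ F, IsClosed A)
    (hp : ∀ A ∈ F, ∀ B ∈ F, (A ∩ B).Nonempty) {C : Set X} (hC : Bornology.IsBounded C)
    (hsub : ∀ A ∈ F, A ⊆ C) : (⋂₀ F).Nonempty := by
  classical
  obtain ⟨A₀, hA₀⟩ := hF
  have : Nonempty {s : Finset (Set X) // (s : Set (Set X)) ⊆ F} := ⟨⟨∅, by simp⟩⟩
  suffices h : ∃ p, ∀ s : {s : Finset (Set X) // (s : Set (Set X)) ⊆ F},
      p ∈ A₀ ∩ ⋂₀ (s.1 : Set (Set X)) by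
    obtain ⟨p, hp⟩ := h
    refine ⟨p, fun A hA => ?_⟩
    have := (hp ⟨{A}, by simpa using hA⟩).2
    simpa using this
  refine hμ.exists_forall_mem_of_directed _ ?_ ?_ ?_ ?_ hC ?_
  · intro s t
    refine ⟨⟨s.1 ∪ t.1, by simpa using ⟨s.2, t.2⟩⟩, ?_, ?_⟩
    · refine inter_subset_inter_right _ (sInter_subset_sInter ?_)
      simp
    · refine inter_subset_inter_right _ (sInter_subset_sInter ?_)
      simp
  · intro s
    refine hμ.helly_finset s.1 (fun A hA => hconv A (s.2 hA))
      (fun A hA B hB => hp A (s.2 hA) B (s.2 hB)) (hconv A₀ hA₀) ?_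
      fun A hA => hp A₀ hA₀ A (s.2 hA)
    simpa using hp A₀ hA₀ A₀ hA₀
  · exact fun s => (hcl A₀ hA₀).inter (isClosed_sInter fun A hA => hcl A (s.2 hA))
  · exact fun s => (hconv A₀ hA₀).inter (MedConvex.sInter fun A hA => hconv A (s.2 hA))
  · exact fun s => inter_subset_left.trans (hsub A₀ hA₀)

end IsMedianOp

lemma isGate_self {X : Type*} [MetricSpace X] {C : Set X} {x : X} (hx : x ∈ C) : IsGate C x x :=
  ⟨hx, fun c _ => between_left x c⟩

lemma IsGate.mem_of_convex {X : Type*} [MetricSpace X] {C E : Set X} {x p : X}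
    (hp : IsGate C x p) (hE : MedConvex E) (hx : x ∈ E) (hne : (C ∩ E).Nonempty) : p ∈ E := by
  obtain ⟨c, hcC, hcE⟩ := hne
  exact hE hx hcE (hp.2 c hcC)

lemma cubeMedian_comm₁₂ {m : ℕ} (x y z : Fin m → Bool) :
    cubeMedian m x y z = cubeMedian m y x z := by
  funext i
  simp only [cubeMedian]
  cases x i <;> cases y i <;> cases z i <;> rfl

lemma cubeMedian_comm₂₃ {m : ℕ} (x y z : Fin m → Bool) :
    cubeMedian m x y z = cubeMedian m x z y := by
  funext i
  simp only [cubeMedian]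
  cases x i <;> cases y i <;> cases z i <;> rfl

namespace IsMedianOp

variable {X : Type*} [MetricSpace X] {μ : X → X → X → X}

/-- The product of a cube with an edge: two parallel cubes, each the projection of the other, form
a cube of one dimension more. -/
lemma cube_of_parallel (hμ : IsMedianOp μ) {m : ℕ} {S : Bool → Set X}
    (hS : ∀ b, MedConvex (S b)) (g : Bool → (Fin m → Bool) → X)
    (hg : ∀ b c t, IsGate (S b) (g c t) (g b t))
    (hom : ∀ b x y z, g b (cubeMedian m x y z) = μ (g b x) (g b y) (g b z))
    (x y z : Fin (m + 1) → Bool) :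
    g (cubeMedian (m + 1) x y z 0) (Fin.tail (cubeMedian (m + 1) x y z)) =
      μ (g (x 0) (Fin.tail x)) (g (y 0) (Fin.tail y)) (g (z 0) (Fin.tail z)) := by
  have key : ∀ b c x y z, g b (cubeMedian m x y z) = μ (g b x) (g b y) (g c z) :=
    fun b c x y z => (hom b x y z).trans
      (hμ.median_gate (hS b) (hg b b x).1 (hg b b y).1 (hg b c z)).symm
  have key₂ : ∀ b c x y z, g b (cubeMedian m x y z) = μ (g b x) (g c y) (g b z) :=
    fun b c x y z => by rw [cubeMedian_comm₂₃, hμ.comm₂₃]; exact key b c x z y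
  have key₃ : ∀ b c x y z, g b (cubeMedian m x y z) = μ (g c x) (g b y) (g b z) :=
    fun b c x y z => by rw [cubeMedian_comm₁₂, hμ.comm₁₂]; exact key₂ b c y x z
  have htail : Fin.tail (cubeMedian (m + 1) x y z) =
      cubeMedian m (Fin.tail x) (Fin.tail y) (Fin.tail z) := rfl
  rw [htail]
  have h0 : cubeMedian (m + 1) x y z 0 = ((x 0 && y 0) || (y 0 && z 0) || (z 0 && x 0)) := rfl
  rw [h0]
  cases x 0 <;> cases y 0 <;> cases z 0
  · exact hom ..
  · exact key ..
  · exact key₂ ..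
  · exact key₃ ..
  · exact key₃ ..
  · exact key₂ ..
  · exact key ..
  · exact hom ..

/-- Pairwise crossing pairs of closed convex sets yield a cube with one vertex in each sector. -/
lemma exists_cube (hμ : IsMedianOp μ) [CompleteSpace X] (m : ℕ) (D : Fin m → Bool → Set X)
    (hcl : ∀ i b, IsClosed (D i b)) (hconv : ∀ i b, MedConvex (D i b))
    (hcross : ∀ i j, i ≠ j → ∀ b c, (D i b ∩ D j c).Nonempty) {H : Set X} (hHcl : IsClosed H)
    (hH : MedConvex H) (hne : H.Nonempty) (hHD : ∀ i b, (H ∩ D i b).Nonempty) :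
    ∃ f : (Fin m → Bool) → X, (∀ x y z, f (cubeMedian m x y z) = μ (f x) (f y) (f z)) ∧
      ∀ s, f s ∈ H ∧ ∀ i, f s ∈ D i (s i) := by
  induction m generalizing H with
  | zero =>
    obtain ⟨h, hh⟩ := hne
    exact ⟨fun _ => h, fun _ _ _ => (hμ.eq_of_between (between_left h h)).symm,
      fun _ => ⟨hh, fun i => i.elim0⟩⟩
  | succ m ih =>
    let S : Bool → Set X := fun b => H ∩ D 0 b
    have hS : ∀ b, MedConvex (S b) := fun b => hH.inter (hconv 0 b)
    have hScl : ∀ b, IsClosed (S b) := fun b => hHcl.inter (hcl 0 b)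
    have hSD : ∀ b (i : Fin m) c, (S b ∩ D i.succ c).Nonempty := fun b i c =>
      hμ.helly_three hH (hconv 0 b) (hconv i.succ c) (hHD 0 b) (hHD i.succ c)
        (hcross 0 i.succ (Fin.succ_ne_zero i).symm b c)
    obtain ⟨f, hf, hfm⟩ := ih (fun i => D i.succ) (fun i => hcl i.succ) (fun i => hconv i.succ)
      (fun i j hij => hcross i.succ j.succ (by simpa using hij)) (hScl false) (hS false)
      (hHD 0 false) (hSD false)
    choose π hπ using fun b => hμ.exists_isGate (hS b) (hScl b) (hHD 0 b)
    let g : Bool → (Fin m → Bool) → X := fun b t =>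
      if b then π true (f t) else π false (π true (f t))
    have hgS : ∀ b t, g b t ∈ S b := by
      rintro (_ | _) t
      · exact (hπ false _).1
      · exact (hπ true _).1
    have hgg : ∀ b c t, IsGate (S b) (g c t) (g b t) := by
      rintro (_ | _) (_ | _) t
      · exact isGate_self (hgS false t)
      · exact hπ false _
      · have h := hπ true (g false t)
        rwa [IsGate.eq_of_isGate (hfm t).1 (hπ true (f t)) (hπ false _) h] at h
      · exact isGate_self (hgS true t)
    have hom : ∀ b x y z, g b (cubeMedian m x y z) = μ (g b x) (g b y) (g b z) := by
      have h₁ : ∀ x y z, g true (cubeMedian m x y z) = μ (g true x) (g true y) (g true z) :=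
        fun x y z => hμ.gate_median (hS true) (hπ true (f x)) (hπ true (f y)) (hπ true (f z))
          (hf x y z ▸ hπ true _)
      rintro (_ | _) x y z
      · exact hμ.gate_median (hS false) (hgg false true x) (hgg false true y) (hgg false true z)
          (h₁ x y z ▸ hgg false true _)
      · exact h₁ x y z
    refine ⟨fun s => g (s 0) (Fin.tail s), hμ.cube_of_parallel hS g hgg hom,
      fun s => ⟨(hgS _ _).1, fun i => ?_⟩⟩
    have hmem : ∀ b t (i : Fin m), g b t ∈ D i.succ (t i) := by
      have h₁ : ∀ t (i : Fin m), g true t ∈ D i.succ (t i) := fun t i =>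
        (hπ true (f t)).mem_of_convex (hconv _ _) ((hfm t).2 i) (hSD _ _ _)
      rintro (_ | _) t i
      · exact (hπ false _).mem_of_convex (hconv _ _) (h₁ t i) (hSD _ _ _)
      · exact h₁ t i
    refine Fin.cases ?_ (fun i => ?_) i
    · exact (hgS _ _).2
    · exact hmem (s 0) (Fin.tail s) i

/-- In a median space of rank at most `n` there are at most `n` pairwise crossing pairs of disjoint
closed convex sets. -/
lemma not_crossing (hμ : IsMedianOp μ) [CompleteSpace X] {n : ℕ} (hrank : RankLE μ n)
    (D : Fin (n + 1) → Bool → Set X) (hcl : ∀ i b, IsClosed (D i b))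
    (hconv : ∀ i b, MedConvex (D i b)) (hne : ∀ i b, (D i b).Nonempty)
    (hcross : ∀ i j, i ≠ j → ∀ b c, (D i b ∩ D j c).Nonempty)
    (hdisj : ∀ i, Disjoint (D i false) (D i true)) : False := by
  obtain ⟨x, -⟩ := hne 0 true
  obtain ⟨f, hf, hfm⟩ := hμ.exists_cube (n + 1) D hcl hconv hcross isClosed_univ
    (fun _ _ _ _ _ _ => mem_univ _) ⟨x, mem_univ _⟩ (by simpa using hne)
  refine hrank ⟨f, fun s t hst => ?_, hf⟩
  funext i
  have h₁ := (hfm s).2 i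
  have h₂ := (hfm t).2 i
  rw [hst] at h₁
  by_contra hne
  cases hs : s i <;> cases ht : t i <;> rw [hs] at h₁ <;> rw [ht] at h₂
  · exact hne (hs.trans ht.symm)
  · exact (hdisj i).notMem_of_mem_left h₁ h₂
  · exact (hdisj i).notMem_of_mem_left h₂ h₁
  · exact hne (hs.trans ht.symm)

end IsMedianOp

/-- The closed convex hull of a set. -/
def clHull {X : Type*} [MetricSpace X] (S : Set X) : Set X :=
  ⋂₀ {A | IsClosed A ∧ MedConvex A ∧ S ⊆ A}

section ClHull

variable {X : Type*} [MetricSpace X] {S T : Set X}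

lemma subset_clHull (S : Set X) : S ⊆ clHull S :=
  subset_sInter fun _ hA => hA.2.2

lemma isClosed_clHull (S : Set X) : IsClosed (clHull S) :=
  isClosed_sInter fun _ hA => hA.1

lemma medConvex_clHull (S : Set X) : MedConvex (clHull S) :=
  MedConvex.sInter fun _ hA => hA.2.1

lemma clHull_subset (hT : IsClosed T) (hT' : MedConvex T) (h : S ⊆ T) : clHull S ⊆ T :=
  sInter_subset_of_mem ⟨hT, hT', h⟩

lemma clHull_mono (h : S ⊆ T) : clHull S ⊆ clHull T :=
  clHull_subset (isClosed_clHull T) (medConvex_clHull T) (h.trans (subset_clHull T))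

lemma medConvex_singleton (a : X) : MedConvex ({a} : Set X) := by
  rintro _ rfl _ rfl z hz
  exact hz.eq_of_self

end ClHull

namespace IsMedianOp

variable {X : Type*} [MetricSpace X] {μ : X → X → X → X}

lemma median_gate_eq (hμ : IsMedianOp μ) {C : Set X} {z p c : X} (hp : IsGate C z p)
    (hc : c ∈ C) : μ p z c = p :=
  (hμ.uniq _ _ _ _ (between_left p z) (hp.2 c hc) (between_left p c)).symm

/-- The distance from `a` to a point in the hull of a finite set is at most the sum of the distances
from `a` to the points of the set. -/
lemma dist_le_sum_of_mem_clHull (hμ : IsMedianOp μ) [CompleteSpace X] (a : X) (F : Finset X)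
    {z : X} (hz : z ∈ clHull (insert a (F : Set X))) : dist a z ≤ ∑ u ∈ F, dist a u := by
  classical
  induction F using Finset.induction_on generalizing z with
  | empty =>
    have : z = a := clHull_subset isClosed_singleton (medConvex_singleton a) (by simp) hz
    simp [this]
  | insert u F hu ih =>
    have ha := subset_clHull _ (mem_insert a (F : Set X))
    obtain ⟨p, hp⟩ := hμ.exists_isGate (medConvex_clHull (insert a (F : Set X)))
      (isClosed_clHull _) ⟨a, ha⟩ z
    have hsub : clHull (insert a ((insert u F : Finset X) : Set X)) ⊆
        μ p z ⁻¹' {w | Between p w (μ p z u)} := by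
      refine clHull_subset
        (hμ.isClosed_interval_preimage (isClosed_setOf_between _ _) _ _)
        (hμ.medConvex_preimage (hμ.medConvex_interval _ _) _ _) ?_
      rw [Finset.coe_insert, insert_comm, insert_subset_iff]
      refine ⟨between_right _ _, fun k hk => ?_⟩
      rw [mem_preimage, hμ.median_gate_eq hp (subset_clHull _ hk)]
      exact between_left _ _
    have h₁ : Between p z (μ p z u) := by
      have := hsub hz
      rwa [mem_preimage, hμ.eq_of_between (between_right p z)] at this
    have h₂ : z = μ p z u := h₁.antisymm (hμ.btw₁₂ p z u)
    have h₃ := hμ.dist_median_le p z a u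
    rw [hμ.median_gate_eq hp ha, ← h₂] at h₃
    rw [Finset.sum_insert hu]
    linarith [dist_triangle a p z, ih hp.1]

/-- In rank at most `n`, an irredundant spanning set of an interval has at most `n` elements. -/
lemma card_le_of_irredundant (hμ : IsMedianOp μ) [CompleteSpace X] [DecidableEq X] {n : ℕ}
    (hrank : RankLE μ n) {a z : X} {F : Finset X} (hF : ∀ u ∈ F, Between a u z)
    (hz : z ∈ clHull (insert a (F : Set X)))
    (hmin : ∀ u ∈ F, z ∉ clHull (insert a ((F.erase u : Finset X) : Set X))) : F.card ≤ n := by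
  by_contra! hcard
  let e : Fin (n + 1) → X := fun i => F.equivFin.symm (Fin.castLE hcard i)
  have he : ∀ i, e i ∈ F := fun i => (F.equivFin.symm (Fin.castLE hcard i)).2
  have hinj : ∀ i j, i ≠ j → e j ∈ F.erase (e i) := fun i j hij =>
    Finset.mem_erase.2 ⟨fun h => hij (by simpa [e] using h.symm), he j⟩
  let L : Fin (n + 1) → Set X := fun i => clHull (insert a ((F.erase (e i) : Finset X) : Set X))
  have haL : ∀ i, a ∈ L i := fun i => subset_clHull _ (mem_insert _ _)
  have heL : ∀ i j, i ≠ j → e j ∈ L i := fun i j hij =>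
    subset_clHull _ (mem_insert_of_mem _ (hinj i j hij))
  refine hμ.not_crossing hrank (fun i b => if b then {w | Between (e i) w z} else L i)
    ?_ ?_ ?_ ?_ ?_
  · rintro i (_ | _)
    · exact isClosed_clHull _
    · exact isClosed_setOf_between _ _
  · rintro i (_ | _)
    · exact medConvex_clHull _
    · exact hμ.medConvex_interval _ _
  · rintro i (_ | _)
    · exact ⟨a, haL i⟩
    · exact ⟨z, between_right _ _⟩
  · rintro i j hij (_ | _) (_ | _)
    · exact ⟨a, haL i, haL j⟩
    · exact ⟨e j, heL i j hij, between_left _ _⟩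
    · exact ⟨e i, between_left _ _, heL j i hij.symm⟩
    · exact ⟨z, between_right _ _, between_right _ _⟩
  · intro i
    refine Set.disjoint_left.2 fun w (hw : w ∈ L i) (hw' : Between (e i) w z) => ?_
    have h : e i ∈ L i :=
      medConvex_clHull _ (haL i) hw ((hF _ (he i)).left_of_right hw')
    refine hmin _ (he i) (clHull_subset (isClosed_clHull _) (medConvex_clHull _) ?_ hz)
    refine insert_subset (haL i) fun u hu => ?_
    by_cases hui : u = e i
    · rwa [hui]
    · exact subset_clHull _ (mem_insert_of_mem _ (Finset.mem_erase.2 ⟨hui, hu⟩))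

lemma dist_le_of_mem_clHull_finset (hμ : IsMedianOp μ) [CompleteSpace X] {n : ℕ}
    (hrank : RankLE μ n) {a z : X} {δ : ℝ} (hδ : 0 ≤ δ) {F : Finset X}
    (hF : ∀ u ∈ F, dist a u ≤ δ) (hz : z ∈ clHull (insert a (F : Set X))) :
    dist a z ≤ n * δ := by
  classical
  have hz' : z ∈ clHull (insert a ((F.image (μ a z) : Finset X) : Set X)) := by
    have hsub : clHull (insert a (F : Set X)) ⊆
        μ a z ⁻¹' clHull (insert a ((F.image (μ a z) : Finset X) : Set X)) := by
      refine clHull_subset (hμ.isClosed_interval_preimage (isClosed_clHull _) _ _)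
        (hμ.medConvex_preimage (medConvex_clHull _) _ _) (insert_subset ?_ fun u hu => ?_)
      · rw [mem_preimage, hμ.eq_of_between (between_left a z)]
        exact subset_clHull _ (mem_insert _ _)
      · exact subset_clHull _ (mem_insert_of_mem _ (Finset.mem_image_of_mem _ hu))
    have := hsub hz
    rwa [mem_preimage, hμ.eq_of_between (between_right a z)] at this
  obtain ⟨E, hE, hEmin⟩ := exists_minimal_le_of_wellFoundedLT
    (fun E : Finset X => z ∈ clHull (insert a (E : Set X))) _ hz'
  have hEF : ∀ u ∈ E, Between a u z ∧ dist a u ≤ δ := by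
    intro u hu
    obtain ⟨v, hv, rfl⟩ := Finset.mem_image.1 (hE hu)
    refine ⟨hμ.btw₁₂ a z v, le_trans ?_ (hF v hv)⟩
    have := hμ.dist_median_le a z a v
    rwa [hμ.eq_of_between (between_left a z)] at this
  have hcard : E.card ≤ n := hμ.card_le_of_irredundant hrank (fun u hu => (hEF u hu).1)
    hEmin.prop fun u hu h => Finset.notMem_erase u E (hEmin.2 h (Finset.erase_subset u E) hu)
  calc dist a z ≤ ∑ u ∈ E, dist a u := hμ.dist_le_sum_of_mem_clHull a E hEmin.prop
    _ ≤ E.card • δ := Finset.sum_le_card_nsmul _ _ _ fun u hu => (hEF u hu).2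
    _ = E.card * δ := nsmul_eq_mul _ _
    _ ≤ n * δ := by gcongr

/-- In rank at most `n`, the closed convex hull of a ball of radius `δ` is contained in the
concentric ball of radius `n * δ`. -/
lemma clHull_closedBall_subset (hμ : IsMedianOp μ) [CompleteSpace X] {n : ℕ}
    (hrank : RankLE μ n) (a : X) {δ : ℝ} (hδ : 0 ≤ δ) :
    clHull (Metric.closedBall a δ) ⊆ Metric.closedBall a (n * δ) := by
  classical
  let T : Set X := {z | ∃ F : Finset X, (∀ u ∈ F, dist a u ≤ δ) ∧
    z ∈ clHull (insert a (F : Set X))}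
  have hT : MedConvex T := by
    rintro x ⟨F, hF, hx⟩ y ⟨E, hE, hy⟩ z hz
    refine ⟨F ∪ E, fun u hu => (Finset.mem_union.1 hu).elim (hF u) (hE u), ?_⟩
    refine medConvex_clHull _ (clHull_mono ?_ hx) (clHull_mono ?_ hy) hz <;>
    · refine insert_subset_insert ?_
      simp
  have hTball : T ⊆ Metric.closedBall a (n * δ) := by
    rintro z ⟨F, hF, hz⟩
    rw [Metric.mem_closedBall, dist_comm]
    exact hμ.dist_le_of_mem_clHull_finset hrank hδ hF hz
  refine (clHull_subset isClosed_closure (hμ.medConvex_closure hT) fun x hx => ?_).trans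
    (closure_minimal hTball Metric.isClosed_closedBall)
  rw [Metric.mem_closedBall, dist_comm] at hx
  exact subset_closure ⟨{x}, by simpa using hx, subset_clHull _ (by simp)⟩

end IsMedianOp

/-- Every point of `C` is within distance `r` of a point of `A`. -/
def Near {X : Type*} [MetricSpace X] (C A : Set X) (r : ℝ) : Prop :=
  ∀ z ∈ C, ∃ a ∈ A, dist z a ≤ r

/-- `C` contains two disjoint closed convex subsets which are both `r`-dense in `C`. -/
def Split {X : Type*} [MetricSpace X] (C : Set X) (r : ℝ) : Prop :=
  ∃ E : Bool → Set X, (∀ b, IsClosed (E b)) ∧ (∀ b, MedConvex (E b)) ∧ (∀ b, E b ⊆ C) ∧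
    (∀ b, Near C (E b) r) ∧ Disjoint (E false) (E true)

lemma Near.mono {X : Type*} [MetricSpace X] {C A : Set X} {r s : ℝ} (h : Near C A r)
    (hrs : r ≤ s) : Near C A s :=
  fun z hz => (h z hz).imp fun _ ha => ⟨ha.1, ha.2.trans hrs⟩

lemma Split.mono {X : Type*} [MetricSpace X] {C : Set X} {r s : ℝ} (h : Split C r)
    (hrs : r ≤ s) : Split C s := by
  obtain ⟨E, h₁, h₂, h₃, h₄, h₅⟩ := h
  exact ⟨E, h₁, h₂, h₃, fun b => (h₄ b).mono hrs, h₅⟩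

lemma MedConvex.preimage {X : Type*} [MetricSpace X] {C : Set X} (hC : MedConvex C) {f : X → X}
    (hf : Isometry f) : MedConvex (f ⁻¹' C) :=
  fun _ hx _ hy _ hz => hC hx hy (hf.between hz)

namespace IsMedianOp

variable {X : Type*} [MetricSpace X] {μ : X → X → X → X}

/-- Intervals of a connected median space contain points at every intermediate distance. -/
lemma exists_between_dist_eq (hμ : IsMedianOp μ) [ConnectedSpace X] (x y : X) {t : ℝ}
    (h₀ : 0 ≤ t) (h₁ : t ≤ dist x y) : ∃ v, Between x v y ∧ dist x v = t := by
  have hcont : Continuous fun z => dist x (μ x y z) :=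
    continuous_const.dist (hμ.continuous_median x y)
  obtain ⟨z, hz⟩ := mem_range_of_exists_le_of_exists_ge hcont (c := t)
    ⟨x, by rwa [hμ.eq_of_between (between_left x y), dist_self]⟩
    ⟨y, by rwa [hμ.eq_of_between (between_right x y)]⟩
  exact ⟨μ x y z, hμ.btw₁₂ x y z, hz⟩

/-- A convex set `A` can be thickened to a closed convex set that is still controlled in the
direction of a given point. -/
lemma exists_thickening (hμ : IsMedianOp μ) [CompleteSpace X] {n : ℕ} (hrank : RankLE μ n)
    {A : Set X} {a z : X} (ha : IsGate A z a) {δ : ℝ} (hδ : 0 ≤ δ) :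
    ∃ A' : Set X, IsClosed A' ∧ MedConvex A' ∧ (∀ x, ∀ c ∈ A, dist x c ≤ δ → x ∈ A') ∧
      ∀ x ∈ A', dist a (μ a z x) ≤ n * δ := by
  refine ⟨μ a z ⁻¹' clHull (Metric.closedBall a δ),
    hμ.isClosed_interval_preimage (isClosed_clHull _) _ _,
    hμ.medConvex_preimage (medConvex_clHull _) _ _, fun x c hc hx => subset_clHull _ ?_,
    fun x hx => ?_⟩
  · have := hμ.dist_median_le a z x c
    rw [hμ.median_gate_eq ha hc] at this
    exact this.trans hx
  · rw [dist_comm]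
    exact hμ.clHull_closedBall_subset hrank a hδ hx

lemma exists_mutual_gates (hμ : IsMedianOp μ) [CompleteSpace X] {A B : Set X}
    (hA : IsClosed A) (hA' : MedConvex A) (hne : A.Nonempty) (hB : IsClosed B)
    (hB' : MedConvex B) (hne' : B.Nonempty) : ∃ a b, IsGate A b a ∧ IsGate B a b := by
  obtain ⟨a₀, ha₀⟩ := hne
  obtain ⟨b, hb⟩ := hμ.exists_isGate hB' hB hne' a₀
  obtain ⟨a, ha⟩ := hμ.exists_isGate hA' hA ⟨a₀, ha₀⟩ b
  obtain ⟨b', hb'⟩ := hμ.exists_isGate hB' hB hne' a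
  exact ⟨a, b, ha, IsGate.eq_of_isGate ha₀ hb ha hb' ▸ hb'⟩

/-- Two disjoint closed convex sets have disjoint closed convex uniform neighbourhoods. -/
lemma exists_disjoint_thickening (hμ : IsMedianOp μ) [CompleteSpace X] {n : ℕ}
    (hrank : RankLE μ n) {E : Bool → Set X} (hcl : ∀ b, IsClosed (E b))
    (hconv : ∀ b, MedConvex (E b)) (hne : ∀ b, (E b).Nonempty)
    (hdisj : Disjoint (E false) (E true)) :
    ∃ δ > 0, ∃ E' : Bool → Set X, (∀ b, IsClosed (E' b)) ∧ (∀ b, MedConvex (E' b)) ∧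
      (∀ b x, ∀ c ∈ E b, dist x c ≤ δ → x ∈ E' b) ∧ Disjoint (E' false) (E' true) := by
  obtain ⟨a, b, ha, hb⟩ := hμ.exists_mutual_gates (hcl false) (hconv false) (hne false)
    (hcl true) (hconv true) (hne true)
  have hab : 0 < dist a b := dist_pos.2 (hdisj.ne_of_mem ha.1 hb.1)
  have hδ : 0 < dist a b / (2 * n + 1) := by positivity
  obtain ⟨A', hA₁, hA₂, hA₃, hA₄⟩ := hμ.exists_thickening hrank ha hδ.le
  obtain ⟨B', hB₁, hB₂, hB₃, hB₄⟩ := hμ.exists_thickening hrank hb hδ.le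
  refine ⟨_, hδ, fun b => if b then B' else A', ?_, ?_, ?_, ?_⟩
  · rintro (_ | _) <;> assumption
  · rintro (_ | _) <;> assumption
  · rintro (_ | _) <;> assumption
  · refine Set.disjoint_left.2 fun x (hx : x ∈ A') (hx' : x ∈ B') => ?_
    have h₁ := hA₄ x hx
    have h₂ := hB₄ x hx'
    rw [hμ.comm₁₂ b a] at h₂
    have h₃ := dist_triangle_right a b (μ a b x)
    have h₄ : (2 * n + 1) * (dist a b / (2 * n + 1)) = dist a b := by field_simp
    linarith

/-- If `C` splits at arbitrarily small scales, it contains arbitrarily large families of crossing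
pairs. -/
lemma exists_crossing_of_split (hμ : IsMedianOp μ) [CompleteSpace X] {n : ℕ}
    (hrank : RankLE μ n) {C : Set X} (hne : C.Nonempty) (h : ∀ ε > 0, Split C ε) (m : ℕ) :
    ∃ D : Fin m → Bool → Set X, (∀ i b, IsClosed (D i b)) ∧ (∀ i b, MedConvex (D i b)) ∧
      (∀ i j, i ≠ j → ∀ b c, (D i b ∩ D j c).Nonempty) ∧
      (∀ i, Disjoint (D i false) (D i true)) ∧
      ∃ δ > 0, ∀ i b, ∃ c ∈ C, ∀ x ∈ C, dist x c ≤ δ → x ∈ D i b := by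
  induction m with
  | zero =>
    exact ⟨fun i => i.elim0, fun i => i.elim0, fun i => i.elim0, fun i => i.elim0,
      fun i => i.elim0, 1, one_pos, fun i => i.elim0⟩
  | succ m ih =>
    obtain ⟨D, hcl, hconv, hcross, hdisj, δ, hδ, hball⟩ := ih
    obtain ⟨E, hEcl, hEconv, hEC, hEnear, hEdisj⟩ := h δ hδ
    have hEne : ∀ b, (E b).Nonempty := fun b => by
      obtain ⟨z, hz⟩ := hne
      obtain ⟨a, ha, -⟩ := hEnear b z hz
      exact ⟨a, ha⟩
    obtain ⟨η, hη, E', hE'cl, hE'conv, hE'E, hE'disj⟩ :=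
      hμ.exists_disjoint_thickening hrank hEcl hEconv hEne hEdisj
    have hmeet : ∀ b i c, (E' b ∩ D i c).Nonempty := fun b i c => by
      obtain ⟨z, hz, hzD⟩ := hball i c
      obtain ⟨a, ha, hd⟩ := hEnear b z hz
      exact ⟨a, hE'E b a a ha (by simpa using hη.le),
        hzD a (hEC b ha) ((dist_comm _ _).trans_le hd)⟩
    refine ⟨Fin.cons E' D, ?_, ?_, ?_, ?_, min δ η, lt_min hδ hη, ?_⟩
    · exact Fin.cases hE'cl hcl
    · exact Fin.cases hE'conv hconv
    · refine Fin.cases (Fin.cases (fun h => (h rfl).elim) fun j _ b c => hmeet b j c)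
        fun i => Fin.cases (fun _ b c => ?_) fun j hij => hcross i j (by simpa using hij)
      rw [inter_comm]
      exact hmeet c i b
    · exact Fin.cases hE'disj hdisj
    · refine Fin.cases (fun b => ?_) fun i b => ?_
      · obtain ⟨c, hc⟩ := hEne b
        exact ⟨c, hEC b hc, fun x _ hx => hE'E b x c hc (hx.trans (min_le_right _ _))⟩
      · obtain ⟨c, hc, hcD⟩ := hball i b
        exact ⟨c, hc, fun x hx hxc => hcD x hx (hxc.trans (min_le_left _ _))⟩

lemma exists_not_split (hμ : IsMedianOp μ) [CompleteSpace X] {n : ℕ} (hrank : RankLE μ n)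
    {C : Set X} (hne : C.Nonempty) : ∃ ε > 0, ¬ Split C ε := by
  by_contra! h
  obtain ⟨D, hcl, hconv, hcross, hdisj, δ, hδ, hball⟩ :=
    hμ.exists_crossing_of_split hrank hne h (n + 1)
  refine hμ.not_crossing hrank D hcl hconv (fun i b => ?_) hcross hdisj
  obtain ⟨c, hc, hcD⟩ := hball i b
  exact ⟨c, hcD c hc (by simpa using hδ.le)⟩

/-- Let `r₀ > 0` be such that `C` does not split at any scale below `r₀`, but splits at scales
arbitrarily close to `r₀`. Then some proper closed convex subset of `C` is `r`-dense for some
`r < r₀`. -/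
lemma exists_proper_near (hμ : IsMedianOp μ) [CompleteSpace X] [ConnectedSpace X] {n : ℕ}
    (hrank : RankLE μ n) {C : Set X} (hcl : IsClosed C) (hconv : MedConvex C) (hne : C.Nonempty)
    {r₀ : ℝ} (hr₀ : 0 < r₀) (hsplit : ∀ s > r₀, ∃ r < s, Split C r) :
    ∃ A, IsClosed A ∧ MedConvex A ∧ A ⊆ C ∧ A ≠ C ∧ ∃ r < r₀, Near C A r := by
  have hδ : 0 < r₀ / (n + 1) := by positivity
  have hnδ : n * (r₀ / (n + 1)) < r₀ := by
    have : (n + 1) * (r₀ / (n + 1)) = r₀ := by field_simp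
    linarith
  set δ := r₀ / (n + 1)
  obtain ⟨r, hr, E, hEcl, hEconv, hEC, hEnear, hEdisj⟩ := hsplit (r₀ + δ) (by linarith)
  obtain ⟨z₀, hz₀⟩ := hne
  obtain ⟨b, hb, -⟩ := hEnear true z₀ hz₀
  obtain ⟨a₀, ha₀, -⟩ := hEnear false z₀ hz₀
  by_cases hE : Near C (E false) (n * δ)
  · exact ⟨E false, hEcl _, hEconv _, hEC _,
      fun h => hEdisj.notMem_of_mem_right hb (h ▸ hEC _ hb), _, hnδ, hE⟩
  · simp only [Near, not_forall, not_exists, not_and, not_le] at hE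
    obtain ⟨z, hz, hzE⟩ := hE
    obtain ⟨a, ha⟩ := hμ.exists_isGate (hEconv false) (hEcl false) ⟨a₀, ha₀⟩ z
    obtain ⟨A, hA₁, hA₂, hA₃, hA₄⟩ := hμ.exists_thickening hrank ha hδ.le
    refine ⟨C ∩ A, hcl.inter hA₁, hconv.inter hA₂, inter_subset_left, fun h => ?_,
      max (r - δ) 0, max_lt (by linarith) hr₀, fun w hw => ?_⟩
    · have h₁ := hA₄ z (h.ge hz).2
      rw [hμ.eq_of_between (between_right a z), dist_comm] at h₁
      exact absurd (hzE a ha.1) (not_lt.2 h₁)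
    · obtain ⟨c, hc, hwc⟩ := hEnear false w hw
      obtain ⟨v, hv, hcv⟩ := hμ.exists_between_dist_eq c w (le_min hδ.le dist_nonneg)
        (min_le_right δ (dist c w))
      refine ⟨v, ⟨hconv (hEC _ hc) hw hv, hA₃ v c hc ?_⟩, ?_⟩
      · rw [dist_comm, hcv]
        exact min_le_left _ _
      · unfold Between at hv
        rw [dist_comm w v]
        rw [dist_comm w c] at hwc
        rcases le_total δ (dist c w) with h | h
        · rw [min_eq_left h] at hcv
          exact le_max_of_le_left (by linarith)
        · rw [min_eq_right h] at hcv
          exact le_max_of_le_right (by linarith)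

variable {G : Type*} [Group G] [MulAction G X]

/-- A bounded invariant closed convex set without proper invariant closed convex subsets is a
point. -/
lemma subsingleton_of_minimal (hμ : IsMedianOp μ) [CompleteSpace X] [ConnectedSpace X] {n : ℕ}
    (hrank : RankLE μ n) (hiso : ∀ g : G, Isometry fun x : X => g • x) {C : Set X}
    (hcl : IsClosed C) (hconv : MedConvex C) (hne : C.Nonempty) (hbdd : Bornology.IsBounded C)
    (hinv : ∀ g : G, ∀ x ∈ C, g • x ∈ C)
    (hmin : ∀ K ⊆ C, IsClosed K → MedConvex K → K.Nonempty → (∀ g : G, ∀ x ∈ K, g • x ∈ K) →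
      K = C) : C.Subsingleton := by
  intro x hx y hy
  by_contra hxy
  obtain ⟨R, hR⟩ := Metric.isBounded_iff.1 hbdd
  have hS : ({r | Split C r} : Set ℝ).Nonempty := by
    refine ⟨R, fun b => if b then {y} else {x}, ?_, ?_, ?_, ?_, by simpa using hxy⟩
    · rintro (_ | _) <;> exact isClosed_singleton
    · rintro (_ | _) <;> exact medConvex_singleton _
    · rintro (_ | _) <;> simpa
    · rintro (_ | _) z hz
      · exact ⟨x, rfl, hR hz hx⟩
      · exact ⟨y, rfl, hR hz hy⟩
  obtain ⟨ε, hε, hεS⟩ := hμ.exists_not_split hrank hne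
  have hlb : ∀ r ∈ {r | Split C r}, ε ≤ r := fun r hr =>
    le_of_not_ge fun h => hεS (Split.mono hr h)
  set r₀ := sInf {r | Split C r}
  have hr₀ : 0 < r₀ := hε.trans_le (le_csInf hS hlb)
  let F : Set (Set X) := {A | IsClosed A ∧ MedConvex A ∧ A ⊆ C ∧ ∃ r < r₀, Near C A r}
  have hCF : C ∈ F := ⟨hcl, hconv, subset_rfl, 0, hr₀, fun z hz => ⟨z, hz, by simp⟩⟩
  have hFpair : ∀ A ∈ F, ∀ B ∈ F, (A ∩ B).Nonempty := by
    rintro A ⟨hA₁, hA₂, hA₃, r, hr, hAr⟩ B ⟨hB₁, hB₂, hB₃, s, hs, hBs⟩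
    by_contra hAB
    rw [← Set.not_disjoint_iff_nonempty_inter, not_not] at hAB
    have hsp : Split C (max r s) := by
      refine ⟨fun b => if b then B else A, ?_, ?_, ?_, ?_, hAB⟩
      · rintro (_ | _) <;> assumption
      · rintro (_ | _) <;> assumption
      · rintro (_ | _) <;> assumption
      · rintro (_ | _)
        · exact hAr.mono (le_max_left _ _)
        · exact hBs.mono (le_max_right _ _)
    exact (max_lt hr hs).not_ge (csInf_le ⟨ε, hlb⟩ hsp)
  have hFinv : ∀ g : G, ∀ A ∈ F, C ∩ (fun x => g • x) ⁻¹' A ∈ F := by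
    rintro g A ⟨hA₁, hA₂, hA₃, r, hr, hAr⟩
    refine ⟨hcl.inter (hA₁.preimage (hiso g).continuous), hconv.inter (hA₂.preimage (hiso g)),
      inter_subset_left, r, hr, fun z hz => ?_⟩
    obtain ⟨a, ha, hza⟩ := hAr (g • z) (hinv g z hz)
    refine ⟨g⁻¹ • a, ⟨hinv _ _ (hA₃ ha), by simpa using ha⟩, ?_⟩
    rw [← (hiso g).dist_eq]
    simpa using hza
  have hFC : ⋂₀ F = C := by
    refine hmin _ (sInter_subset_of_mem hCF) (isClosed_sInter fun A hA => hA.1)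
      (MedConvex.sInter fun A hA => hA.2.1)
      (hμ.helly ⟨C, hCF⟩ (fun A hA => hA.2.1) (fun A hA => hA.1) hFpair hbdd
        fun A hA => hA.2.2.1) fun g x hx A hA => (hx _ (hFinv g A hA)).2
  obtain ⟨A, hA₁, hA₂, hA₃, hAC, hA₄⟩ := hμ.exists_proper_near hrank hcl hconv hne hr₀
    fun s hs => (exists_lt_of_csInf_lt hS hs).imp fun r hr => ⟨hr.2, hr.1⟩
  exact hAC (hA₃.antisymm (hFC.ge.trans (sInter_subset_of_mem ⟨hA₁, hA₂, hA₃, hA₄⟩)))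

/-- A nonempty bounded invariant closed convex set contains a minimal one. -/
lemma exists_minimal_invariant (hμ : IsMedianOp μ) [CompleteSpace X] {C : Set X}
    (hcl : IsClosed C) (hconv : MedConvex C) (hne : C.Nonempty) (hbdd : Bornology.IsBounded C)
    (hinv : ∀ g : G, ∀ x ∈ C, g • x ∈ C) :
    ∃ K, Minimal (· ∈ {K : Set X | IsClosed K ∧ MedConvex K ∧ K.Nonempty ∧ K ⊆ C ∧
      ∀ g : G, ∀ x ∈ K, g • x ∈ K}) K := by
  refine zorn_superset _ fun c hc hchain => ?_
  rcases c.eq_empty_or_nonempty with rfl | hcne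
  · exact ⟨C, ⟨hcl, hconv, hne, subset_rfl, hinv⟩, by simp⟩
  have : Nonempty c := hcne.to_subtype
  have hdir : Directed (· ≥ ·) fun K : c => (K : Set X) := by
    intro K L
    rcases hchain.total K.2 L.2 with h | h
    · exact ⟨K, subset_rfl, h⟩
    · exact ⟨L, h, subset_rfl⟩
  obtain ⟨p, hp⟩ := hμ.exists_forall_mem_of_directed (fun K : c => (K : Set X)) hdir
    (fun K => (hc K.2).2.2.1) (fun K => (hc K.2).1) (fun K => (hc K.2).2.1) hbdd
    fun K => (hc K.2).2.2.2.1
  obtain ⟨K₀, hK₀⟩ := hcne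
  exact ⟨⋂₀ c, ⟨isClosed_sInter fun K hK => (hc hK).1, MedConvex.sInter fun K hK => (hc hK).2.1,
    ⟨p, fun K hK => hp ⟨K, hK⟩⟩, (sInter_subset_of_mem hK₀).trans (hc hK₀).2.2.2.1,
    fun g x hx K hK => (hc hK).2.2.2.2 g x (hx K hK)⟩, fun K hK => sInter_subset_of_mem hK⟩

lemma exists_fixed_point (hμ : IsMedianOp μ) [CompleteSpace X] [ConnectedSpace X] {n : ℕ}
    (hrank : RankLE μ n) (hiso : ∀ g : G, Isometry fun x : X => g • x) {x : X}
    (hx : Bornology.IsBounded (range fun g : G => g • x)) : ∃ p : X, ∀ g : G, g • p = p := by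
  have hmem : ∀ g : G, g • x ∈ clHull (range fun g : G => g • x) := fun g =>
    subset_clHull _ (mem_range_self g)
  obtain ⟨R, hR⟩ := hx.subset_closedBall x
  have hR₀ : 0 ≤ R := by simpa using dist_nonneg.trans (hR (mem_range_self (1 : G)))
  have hinv : ∀ g : G, ∀ y ∈ clHull (range fun g : G => g • x),
      g • y ∈ clHull (range fun g : G => g • x) := by
    intro g
    refine clHull_subset ((isClosed_clHull _).preimage (hiso g).continuous)
      ((medConvex_clHull _).preimage (hiso g)) ?_
    rintro _ ⟨h, rfl⟩
    change g • h • x ∈ clHull _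
    rw [smul_smul]
    exact hmem (g * h)
  have hbdd : Bornology.IsBounded (clHull (range fun g : G => g • x)) :=
    Metric.isBounded_closedBall.subset
      ((clHull_mono hR).trans (hμ.clHull_closedBall_subset hrank x hR₀))
  obtain ⟨K, hK⟩ := hμ.exists_minimal_invariant (isClosed_clHull _) (medConvex_clHull _)
    ⟨_, hmem 1⟩ hbdd hinv
  obtain ⟨hcl, hconv, ⟨p, hp⟩, hKC, hKinv⟩ := hK.prop
  have hsub := hμ.subsingleton_of_minimal hrank hiso hcl hconv ⟨p, hp⟩
    (hbdd.subset hKC) hKinv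
    fun L hLK h₁ h₂ h₃ h₄ => hLK.antisymm (hK.2 ⟨h₁, h₂, h₃, hLK.trans hKC, h₄⟩ hLK)
  exact ⟨p, fun g => hsub (hKinv g p hp) hp⟩

end IsMedianOp

lemma isMedianOp_of_inter_eq {X : Type*} [MetricSpace X] {μ : X → X → X → X}
    (hmedian : ∀ x y z : X,
      {w : X | dist x w + dist w y = dist x y} ∩
          {w : X | dist y w + dist w z = dist y z} ∩
          {w : X | dist z w + dist w x = dist z x} = {μ x y z}) : IsMedianOp μ := by
  have hmem : ∀ x y z, μ x y z ∈ {w : X | dist x w + dist w y = dist x y} ∩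
      {w : X | dist y w + dist w z = dist y z} ∩ {w : X | dist z w + dist w x = dist z x} :=
    fun x y z => hmedian x y z ▸ mem_singleton _
  refine ⟨fun x y z => (hmem x y z).1.1, fun x y z => (hmem x y z).1.2,
    fun x y z => Between.symm (hmem x y z).2, fun x y z w h₁ h₂ h₃ => ?_⟩
  have : w ∈ ({μ x y z} : Set X) := hmedian x y z ▸ ⟨⟨h₁, h₂⟩, h₃.symm⟩
  exact this

/-- Let a group `G` act by isometries on a complete, connected median metric
space `(X, d)` (here `μ` is its intrinsic median operation: the intersection of the three
metric intervals of any triple is the singleton on `μ`) whose intrinsic median algebra has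
rank at most `n`.  Then the action has a fixed point if and only if it has bounded
orbits. -/
theorem stmt_7 {X : Type*} [MetricSpace X] [CompleteSpace X] [ConnectedSpace X]
    (μ : X → X → X → X)
    (hmedian : ∀ x y z : X,
      {w : X | dist x w + dist w y = dist x y} ∩
          {w : X | dist y w + dist w z = dist y z} ∩
          {w : X | dist z w + dist w x = dist z x} = {μ x y z})
    (n : ℕ) (hrank : RankLE μ n)
    (G : Type*) [Group G] [MulAction G X]
    (hiso : ∀ g : G, Isometry fun x : X => g • x) :
    (∃ x : X, ∀ g : G, g • x = x) ↔
      ∀ x : X, Bornology.IsBounded (Set.range fun g : G => g • x) := by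
  have hμ := isMedianOp_of_inter_eq hmedian
  constructor
  · rintro ⟨p, hp⟩ x
    refine Metric.isBounded_closedBall (x := p) (r := dist x p) |>.subset ?_
    rintro _ ⟨g, rfl⟩
    have := (hiso g).dist_eq x p
    simp only [hp] at this
    exact this.le
  · intro h
    obtain ⟨x⟩ := (inferInstance : Nonempty X)
    exact hμ.exists_fixed_point hrank hiso (h x)
end
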